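/- Let Δ be the tetrahedral group [3,5,3]⁺, let p be an odd prime with p ≡ ±2 (mod 5), and let s ∈ F_{p²} satisfy s² = 5. If 3+2s and 3−2s are both squares in F_{p²}, then Δ has exactly two normal subgroups K with Δ/K isomorphic to PSL(2, F_{p²}). -/

import Mathlib

/-- The relators of the tetrahedral group `Δ = [3,5,3]⁺`, on generators
`α = of 0`, `β = of 1`, `γ = of 2`. -/
def tetRelators : Set (FreeGroup (Fin 3)) :=
  { FreeGroup.of 0 ^ 3, FreeGroup.of 1 ^ 5, FreeGroup.of 2 ^ 3,
    (FreeGroup.of 0 * FreeGroup.of 1) ^ 2, (FreeGroup.of 1 * FreeGroup.of 2) ^ 2,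
    (FreeGroup.of 0 * FreeGroup.of 1 * FreeGroup.of 2) ^ 2 }

/-- The tetrahedral group `Δ = [3,5,3]⁺` as a presented group. -/
abbrev Tet : Type := PresentedGroup tetRelators

/-- `K` is a normal subgroup of `Δ` with `Δ/K ≅ PSL(2, F)`. -/
def IsPSLQuotient (F : Type) [Field F] (K : Subgroup Tet) : Prop :=
  ∃ f : Tet →* Matrix.ProjectiveSpecialLinearGroup (Fin 2) F,
    Function.Surjective f ∧ f.ker = K

namespace TetPSL

open scoped MatrixGroups
open Matrix

section SL2

variable {F : Type*} [Field F]

/-- The element of `SL(2, F)` with the given entries. -/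
def mat (a b c d : F) (h : a * d - b * c = 1) : SL(2, F) :=
  ⟨!![a, b; c, d], by rw [det_fin_two_of]; exact h⟩

section mat
variable {a b c d : F} (h : a * d - b * c = 1)
@[simp] lemma mat_zero_zero : (mat a b c d h).1 0 0 = a := rfl
@[simp] lemma mat_zero_one : (mat a b c d h).1 0 1 = b := rfl
@[simp] lemma mat_one_zero : (mat a b c d h).1 1 0 = c := rfl
@[simp] lemma mat_one_one : (mat a b c d h).1 1 1 = d := rfl
end mat

lemma sl_ext {g h : SL(2, F)} (h1 : g.1 0 0 = h.1 0 0) (h2 : g.1 0 1 = h.1 0 1)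
    (h3 : g.1 1 0 = h.1 1 0) (h4 : g.1 1 1 = h.1 1 1) : g = h := by
  apply Matrix.SpecialLinearGroup.ext
  intro i j
  fin_cases i <;> fin_cases j <;> assumption

lemma sl_ext_iff {g h : SL(2, F)} : g = h ↔ g.1 0 0 = h.1 0 0 ∧ g.1 0 1 = h.1 0 1 ∧
    g.1 1 0 = h.1 1 0 ∧ g.1 1 1 = h.1 1 1 :=
  ⟨fun e => by subst e; simp, fun ⟨a, b, c, d⟩ => sl_ext a b c d⟩

lemma det_eq (g : SL(2, F)) : g.1 0 0 * g.1 1 1 - g.1 0 1 * g.1 1 0 = 1 := by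
  rw [← det_fin_two]; exact g.2

lemma val_mul (g h : SL(2, F)) : (g * h).1 = g.1 * h.1 := rfl

section entries
variable (g h : SL(2, F))
@[simp] lemma mul_zero_zero : (g * h).1 0 0 = g.1 0 0 * h.1 0 0 + g.1 0 1 * h.1 1 0 := by
  simp [mul_apply, Fin.sum_univ_two]
@[simp] lemma mul_zero_one : (g * h).1 0 1 = g.1 0 0 * h.1 0 1 + g.1 0 1 * h.1 1 1 := by
  simp [mul_apply, Fin.sum_univ_two]
@[simp] lemma mul_one_zero : (g * h).1 1 0 = g.1 1 0 * h.1 0 0 + g.1 1 1 * h.1 1 0 := by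
  simp [mul_apply, Fin.sum_univ_two]
@[simp] lemma mul_one_one : (g * h).1 1 1 = g.1 1 0 * h.1 0 1 + g.1 1 1 * h.1 1 1 := by
  simp [mul_apply, Fin.sum_univ_two]
@[simp] lemma inv_zero_zero : (g⁻¹).1 0 0 = g.1 1 1 := by
  rw [Matrix.SpecialLinearGroup.SL2_inv_expl]; rfl
@[simp] lemma inv_zero_one : (g⁻¹).1 0 1 = -g.1 0 1 := by
  rw [Matrix.SpecialLinearGroup.SL2_inv_expl]; rfl
@[simp] lemma inv_one_zero : (g⁻¹).1 1 0 = -g.1 1 0 := by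
  rw [Matrix.SpecialLinearGroup.SL2_inv_expl]; rfl
@[simp] lemma inv_one_one : (g⁻¹).1 1 1 = g.1 0 0 := by
  rw [Matrix.SpecialLinearGroup.SL2_inv_expl]; rfl
@[simp] lemma one_zero_zero : (1 : SL(2, F)).1 0 0 = 1 := by simp
@[simp] lemma one_zero_one : (1 : SL(2, F)).1 0 1 = 0 := by simp
@[simp] lemma one_one_zero : (1 : SL(2, F)).1 1 0 = 0 := by simp
@[simp] lemma one_one_one : (1 : SL(2, F)).1 1 1 = 1 := by simp
@[simp] lemma neg_entry (i j : Fin 2) : (-g).1 i j = -g.1 i j := by simp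
end entries

/-- The trace on `SL(2, F)`. -/
def tr (g : SL(2, F)) : F := g.1 0 0 + g.1 1 1

lemma tr_conj (g h : SL(2, F)) : tr (h * g * h⁻¹) = tr g := by
  simp only [tr, mul_zero_zero, mul_zero_one, mul_one_zero, mul_one_one, inv_zero_zero,
    inv_zero_one, inv_one_zero, inv_one_one]
  linear_combination (g.1 0 0 + g.1 1 1) * det_eq h

lemma tr_conj' (g h : SL(2, F)) : tr (h⁻¹ * g * h) = tr g := by
  simpa using tr_conj g h⁻¹

@[simp] lemma tr_neg (g : SL(2, F)) : tr (-g) = -tr g := by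
  simp only [tr, neg_entry]; ring

@[simp] lemma tr_one : tr (1 : SL(2, F)) = 2 := by
  simp only [tr, one_zero_zero, one_one_one]; norm_num

/-- Being plus or minus the identity matrix. -/
def IsPM (g : SL(2, F)) : Prop := g = 1 ∨ g = -1

lemma IsPM.neg {g : SL(2, F)} (h : IsPM g) : IsPM (-g) := by
  rcases h with rfl | rfl
  · right; rfl
  · left; simp

lemma isPM_neg {g : SL(2, F)} : IsPM (-g) ↔ IsPM g :=
  ⟨fun h => by simpa using h.neg, IsPM.neg⟩

lemma isPM_one : IsPM (1 : SL(2, F)) := Or.inl rfl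

lemma isPM_iff {g : SL(2, F)} :
    IsPM g ↔ g.1 0 1 = 0 ∧ g.1 1 0 = 0 ∧ g.1 0 0 = g.1 1 1 := by
  constructor
  · rintro (rfl | rfl)
    · simp
    · simp
  · rintro ⟨h1, h2, h3⟩
    have := det_eq g
    rw [h1, h2, h3] at this
    have h4 : (g.1 1 1 - 1) * (g.1 1 1 + 1) = 0 := by linear_combination this
    rcases mul_eq_zero.1 h4 with h | h
    · left
      apply sl_ext <;> simp <;> grind
    · right
      apply sl_ext <;> simp <;> grind

lemma isPM_conj {g h : SL(2, F)} : IsPM (h * g * h⁻¹) ↔ IsPM g := by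
  have key : ∀ g h : SL(2, F), IsPM g → IsPM (h * g * h⁻¹) := by
    rintro g h (rfl | rfl)
    · left; simp
    · right; simp
  refine ⟨fun H => ?_, key g h⟩
  have := key _ h⁻¹ H
  simpa [mul_assoc] using this

lemma isPM_conj' {g h : SL(2, F)} : IsPM (h⁻¹ * g * h) ↔ IsPM g := by
  simpa using isPM_conj (g := g) (h := h⁻¹)

lemma IsPM.tr_sq {g : SL(2, F)} (h : IsPM g) : tr g ^ 2 = 4 := by
  rcases h with rfl | rfl <;> simp <;> norm_num

lemma one_ne_neg_one (h2 : (2 : F) ≠ 0) : (1 : SL(2, F)) ≠ -1 := by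
  intro h
  have := (sl_ext_iff.1 h).1
  simp at this
  exact h2 (by linear_combination this)

lemma mem_center {g : SL(2, F)} : g ∈ Subgroup.center SL(2, F) ↔ IsPM g := by
  rw [Matrix.SpecialLinearGroup.mem_center_iff]
  constructor
  · rintro ⟨r, -, hr⟩
    rw [isPM_iff, ← hr]
    simp
  · rintro (rfl | rfl)
    · exact ⟨1, by simp, by simp⟩
    · refine ⟨-1, by simp, ?_⟩
      ext i j
      fin_cases i <;> fin_cases j <;> simp

/-! Powers through the Cayley-Hamilton identity. -/

lemma sq_val (g : SL(2, F)) : (g ^ 2).1 = tr g • g.1 - 1 := by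
  have := det_eq g
  ext i j
  fin_cases i <;> fin_cases j <;> simp [pow_two, tr] <;> grind

lemma pow_three_val (g : SL(2, F)) : (g ^ 3).1 = (tr g ^ 2 - 1) • g.1 - tr g • 1 := by
  rw [pow_succ, val_mul, sq_val, sub_mul, smul_mul_assoc, one_mul,
    ← val_mul, ← pow_two, sq_val]
  module

lemma pow_five_val (g : SL(2, F)) :
    (g ^ 5).1 = (tr g ^ 4 - 3 * tr g ^ 2 + 1) • g.1 - (tr g ^ 3 - 2 * tr g) • 1 := by
  rw [show 5 = 3 + 2 from rfl, pow_add, val_mul, pow_three_val, sub_mul,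
    smul_mul_assoc, smul_mul_assoc, one_mul, sq_val, mul_sub, mul_smul_comm, mul_one,
    ← val_mul, ← pow_two, sq_val]
  module

lemma coeff_eq_zero_of_isPM {g k : SL(2, F)} {a b : F} (hk : k.1 = a • g.1 - b • 1)
    (hpm : IsPM k) (hg : ¬ IsPM g) : a = 0 := by
  by_contra ha
  rw [isPM_iff, hk] at hpm
  simp at hpm
  apply hg
  rw [isPM_iff]
  obtain ⟨h1, h2, h3⟩ := hpm
  refine ⟨?_, ?_, ?_⟩
  · tauto
  · tauto
  · rcases h3 with h3 | h3
    · exact h3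
    · exact absurd h3 ha

lemma tr_eq_zero_of_sq {g : SL(2, F)} (h : IsPM (g ^ 2)) (hg : ¬ IsPM g) : tr g = 0 :=
  coeff_eq_zero_of_isPM (b := 1) (by rw [sq_val, one_smul]) h hg

lemma tr_sq_of_cube {g : SL(2, F)} (h : IsPM (g ^ 3)) (hg : ¬ IsPM g) : tr g ^ 2 = 1 := by
  linear_combination coeff_eq_zero_of_isPM (pow_three_val g) h hg

lemma tr_of_pow_five {g : SL(2, F)} (h : IsPM (g ^ 5)) (hg : ¬ IsPM g) :
    tr g ^ 4 - 3 * tr g ^ 2 + 1 = 0 :=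
  coeff_eq_zero_of_isPM (pow_five_val g) h hg

lemma sq_eq_neg_one {g : SL(2, F)} (h : tr g = 0) : g ^ 2 = -1 := by
  apply Subtype.ext
  rw [sq_val, h]; simp

lemma cube_eq_one {g : SL(2, F)} (h : tr g = -1) : g ^ 3 = 1 := by
  apply Subtype.ext
  rw [pow_three_val, h]; simp

lemma pow_five_eq_one {g : SL(2, F)} (h : tr g ^ 2 + tr g - 1 = 0) : g ^ 5 = 1 := by
  apply Subtype.ext
  rw [pow_five_val, show tr g ^ 4 - 3 * tr g ^ 2 + 1 = 0 by
    linear_combination (tr g ^ 2 - tr g - 1) * h,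
    show tr g ^ 3 - 2 * tr g = -1 by linear_combination (tr g - 1) * h]
  simp

lemma tr_of_cube_eq_one {g : SL(2, F)} (h : g ^ 3 = 1) (hg : ¬ IsPM g) : tr g = -1 := by
  have h1 := tr_sq_of_cube (h ▸ isPM_one) hg
  have h2 := pow_three_val g
  rw [h, h1] at h2
  have := congrFun (congrFun h2 0) 0
  simp at this
  linear_combination this

lemma tr_of_pow_five_eq_one {g : SL(2, F)} (h : g ^ 5 = 1) (hg : ¬ IsPM g) :
    tr g ^ 2 + tr g - 1 = 0 := by
  have h1 := tr_of_pow_five (h ▸ isPM_one) hg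
  have h2 := pow_five_val g
  rw [h, h1] at h2
  have := congrFun (congrFun h2 0) 0
  simp at this
  linear_combination tr g * this - h1

/-! Generation by elementary matrices. -/

/-- Upper unitriangular matrices. -/
def up (t : F) : SL(2, F) := mat 1 t 0 1 (by ring)

/-- Lower unitriangular matrices. -/
def lo (t : F) : SL(2, F) := mat 1 0 t 1 (by ring)

lemma eq_top_of_up_lo {H : Subgroup SL(2, F)} (hu : ∀ t, up t ∈ H) (hl : ∀ t, lo t ∈ H) :
    H = ⊤ := by
  rw [eq_top_iff]
  rintro g -
  induction g using Matrix.SL2.transvection_induction with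
  | htransvec i j h c =>
    have : (∃ t, Matrix.SpecialLinearGroup.transvection h c = up t) ∨
        (∃ t, Matrix.SpecialLinearGroup.transvection h c = lo t) := by
      fin_cases i <;> fin_cases j
      · exact absurd rfl h
      · left; refine ⟨c, sl_ext ?_ ?_ ?_ ?_⟩ <;>
          simp [up, SpecialLinearGroup.transvection, transvection]
      · right; refine ⟨c, sl_ext ?_ ?_ ?_ ?_⟩ <;>
          simp [lo, SpecialLinearGroup.transvection, transvection]
      · exact absurd rfl h
    rcases this with ⟨t, ht⟩ | ⟨t, ht⟩ <;> rw [ht]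
    exacts [hu t, hl t]
  | hmul A B hA hB => exact H.mul_mem hA hB

lemma eq_top_of_up {H : Subgroup SL(2, F)} (hu : ∀ t, up t ∈ H) {h : SL(2, F)} (hh : h ∈ H)
    (hc : h.1 1 0 ≠ 0) : H = ⊤ := by
  apply eq_top_of_up_lo hu
  intro t
  set w := up (-h.1 0 0 / h.1 1 0) * h * up (-h.1 1 1 / h.1 1 0) with hw
  have hwH : w ∈ H := H.mul_mem (H.mul_mem (hu _) hh) (hu _)
  have : lo t = w * up (-t / h.1 1 0 ^ 2) * w⁻¹ := by
    have hd := det_eq h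
    have : w = mat 0 (-1 / h.1 1 0) (h.1 1 0) 0 (by field_simp; ring) := by
      apply sl_ext <;> simp [hw, up] <;> field_simp <;> grind
    rw [this]
    apply sl_ext <;> simp [up, lo] <;> field_simp
  rw [this]
  exact H.mul_mem (H.mul_mem hwH (hu _)) (H.inv_mem hwH)

/-- A noncentral element whose trace is plus or minus two is conjugate, up to sign, to an upper
unitriangular matrix. -/
lemma exists_conj_up {g : SL(2, F)} (ht : tr g = 2) :
    ∃ (P : SL(2, F)) (b : F), P⁻¹ * g * P = up b := by
  have hd := det_eq g
  have ht' : g.1 1 1 = 2 - g.1 0 0 := by rw [← ht, tr]; ring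
  by_cases hc : g.1 1 0 = 0
  · refine ⟨1, g.1 0 1, ?_⟩
    have : g.1 0 0 = 1 := by
      rw [hc, ht'] at hd
      have : (g.1 0 0 - 1) ^ 2 = 0 := by linear_combination -hd
      have := pow_eq_zero_iff (two_ne_zero) |>.1 this
      linear_combination this
    apply sl_ext <;> simp [up] <;> grind
  · refine ⟨mat ((g.1 0 0 - 1) / g.1 1 0) (-1) 1 0 (by ring), -g.1 1 0, ?_⟩
    apply sl_ext <;> simp [up] <;> field_simp <;> grind

end SL2

section FixedPoints

variable {F : Type*} [Field F] {K : Type*} [Field K] [DecidableEq K] [Algebra F K]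

open OnePoint

/-- The action of `SL(2, F)` on the projective line over an extension field by Möbius
transformations. -/
instance mobius : MulAction SL(2, F) (OnePoint K) :=
  MulAction.compHom (OnePoint K) (SpecialLinearGroup.mapGL K : SL(2, F) →* GL (Fin 2) K)

lemma mobius_def (g : SL(2, F)) (x : OnePoint K) :
    g • x = (SpecialLinearGroup.mapGL K g : GL (Fin 2) K) • x := rfl

omit [DecidableEq K] in
lemma mapGL_entry (g : SL(2, F)) (i j : Fin 2) :
    (SpecialLinearGroup.mapGL K g : GL (Fin 2) K) i j = algebraMap F K (g.1 i j) := by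
  simp

lemma smul_infty_iff (g : SL(2, F)) : g • (∞ : OnePoint K) = ∞ ↔ g.1 1 0 = 0 := by
  rw [mobius_def, smul_infty_eq_self_iff, mapGL_entry]; simp

lemma smul_coe_iff (g : SL(2, F)) (z : K) : g • (z : OnePoint K) = z ↔
    algebraMap F K (g.1 1 0) * z ^ 2 + (algebraMap F K (g.1 1 1) - algebraMap F K (g.1 0 0)) * z
      - algebraMap F K (g.1 0 1) = 0 := by
  rw [mobius_def, ← Matrix.GeneralLinearGroup.fixpointPolynomial_aeval_eq_zero_iff]
  simp only [Matrix.GeneralLinearGroup.fixpointPolynomial, mapGL_entry]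
  simp

lemma IsPM.smul_eq {g : SL(2, F)} (h : IsPM g) (x : OnePoint K) : g • x = x := by
  rw [isPM_iff] at h
  obtain ⟨h1, h2, h3⟩ := h
  cases x with
  | infty => rw [smul_infty_iff]; exact h2
  | coe z => rw [smul_coe_iff, h1, h2, h3]; simp

lemma fixed_ncard_of_tr_sq_eq (h2 : (2 : F) ≠ 0) {g : SL(2, F)} (hg : ¬ IsPM g)
    (ht : tr g ^ 2 = 4) : {x : OnePoint K | g • x = x}.ncard = 1 := by
  have hd := det_eq g
  simp only [tr] at ht
  rw [Set.ncard_eq_one]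
  by_cases hc : g.1 1 0 = 0
  · refine ⟨∞, ?_⟩
    ext x
    cases x with
    | infty => simp [smul_infty_iff, hc]
    | coe z =>
      have had : g.1 0 0 = g.1 1 1 := by
        have : (g.1 0 0 - g.1 1 1) ^ 2 = 0 := by rw [hc] at hd; linear_combination ht - 4 * hd
        have := pow_eq_zero_iff (two_ne_zero) |>.1 this
        linear_combination this
      have hb : g.1 0 1 ≠ 0 := fun hb => hg (isPM_iff.2 ⟨hb, hc, had⟩)
      simp [smul_coe_iff, hc, had, hb]
  · refine ⟨((algebraMap F K ((g.1 0 0 - g.1 1 1) / (2 * g.1 1 0)) : K) : OnePoint K), ?_⟩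
    ext x
    cases x with
    | infty => simp [smul_infty_iff, hc]
    | coe z =>
      simp only [Set.mem_ofPred_eq, smul_coe_iff, Set.mem_singleton_iff, OnePoint.coe_eq_coe]
      have hc' : algebraMap F K (g.1 1 0) ≠ 0 := by simpa using hc
      have h2' : (2 : K) ≠ 0 := by
        rw [← map_ofNat (algebraMap F K) 2]; simpa using h2
      rw [map_div₀, eq_div_iff (by simp [hc, h2])]
      simp only [map_sub, map_mul, map_ofNat]
      have hd' := congrArg (algebraMap F K) hd
      have ht' := congrArg (algebraMap F K) ht
      simp only [map_sub, map_mul, map_add, map_pow, map_ofNat, map_one] at hd' ht'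
      generalize algebraMap F K (g.1 0 0) = a at *
      generalize algebraMap F K (g.1 0 1) = b at *
      generalize algebraMap F K (g.1 1 0) = c at *
      generalize algebraMap F K (g.1 1 1) = d at *
      have key : 4 * c * (c * z ^ 2 + (d - a) * z - b) = (z * (2 * c) - (a - d)) ^ 2 := by
        linear_combination -ht' + 4 * hd'
      constructor
      · intro h
        rw [h, mul_zero] at key
        have := pow_eq_zero_iff (two_ne_zero) |>.1 key.symm
        linear_combination this
      · intro h
        rw [h, sub_self] at key
        have h4 : (4 * c : K) ≠ 0 := by
          rw [show (4 : K) = 2 * 2 by norm_num]; simp [h2', hc']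
        simpa [h4, hc'] using key

lemma fixed_ncard_of_tr_sq_ne [IsAlgClosed K] (h2 : (2 : F) ≠ 0) {g : SL(2, F)}
    (ht : tr g ^ 2 ≠ 4) : {x : OnePoint K | g • x = x}.ncard = 2 := by
  have hd := det_eq g
  simp only [tr] at ht
  rw [Set.ncard_eq_two]
  have hd' := congrArg (algebraMap F K) hd
  have ht' := (algebraMap F K).injective.ne ht
  simp only [map_sub, map_mul, map_add, map_pow, map_ofNat, map_one] at hd' ht'
  by_cases hc : g.1 1 0 = 0
  · refine ⟨∞, ((algebraMap F K (g.1 0 1) / (algebraMap F K (g.1 1 1) - algebraMap F K (g.1 0 0)) : K)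
      : OnePoint K), by simp, ?_⟩
    ext x
    cases x with
    | infty => simp [smul_infty_iff, hc]
    | coe z =>
      have had : algebraMap F K (g.1 1 1) - algebraMap F K (g.1 0 0) ≠ 0 := by
        intro h
        apply ht'
        rw [hc, map_zero] at hd'
        linear_combination (algebraMap F K (g.1 1 1) - algebraMap F K (g.1 0 0)) * h + 4 * hd'
      simp [smul_coe_iff, hc]
      rw [eq_div_iff had, sub_eq_zero, mul_comm]
  · have hc' : algebraMap F K (g.1 1 0) ≠ 0 := by simpa using hc
    have h2' : (2 : K) ≠ 0 := by
        rw [← map_ofNat (algebraMap F K) 2]; simpa using h2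
    obtain ⟨e, he⟩ := IsAlgClosed.exists_pow_nat_eq
      ((algebraMap F K (g.1 0 0) + algebraMap F K (g.1 1 1)) ^ 2 - 4) (n := 2) (by norm_num)
    refine ⟨(((algebraMap F K (g.1 0 0) - algebraMap F K (g.1 1 1) + e) /
      (2 * algebraMap F K (g.1 1 0)) : K) : OnePoint K),
      (((algebraMap F K (g.1 0 0) - algebraMap F K (g.1 1 1) - e) /
      (2 * algebraMap F K (g.1 1 0)) : K) : OnePoint K), ?_, ?_⟩
    · rw [Ne, OnePoint.coe_eq_coe, div_left_inj' (by simp [hc, h2'])]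
      intro h
      have : 2 * e = 0 := by linear_combination h
      have : e = 0 := by simpa [h2'] using this
      apply ht'
      rw [this] at he
      linear_combination -he
    · ext x
      cases x with
      | infty => simp [smul_infty_iff, hc]
      | coe z =>
        simp only [Set.mem_ofPred_eq, smul_coe_iff, Set.mem_singleton_iff, OnePoint.coe_eq_coe,
          Set.mem_insert_iff]
        rw [eq_div_iff (by simp [hc, h2']), eq_div_iff (by simp [hc, h2'])]
        generalize algebraMap F K (g.1 0 0) = a at *
        generalize algebraMap F K (g.1 0 1) = b at *
        generalize algebraMap F K (g.1 1 0) = c at *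
        generalize algebraMap F K (g.1 1 1) = d at *
        have h4 : (4 * c : K) ≠ 0 := by
          rw [show (4 : K) = 2 * 2 by norm_num]; simp [h2', hc']
        have key : 4 * c * (c * z ^ 2 + (d - a) * z - b) =
            (z * (2 * c) - (a - d + e)) * (z * (2 * c) - (a - d - e)) := by
          linear_combination he + 4 * hd'
        rw [← sub_eq_zero (b := a - d + e), ← sub_eq_zero (b := a - d - e), ← mul_eq_zero, ← key]
        simp [hc', show (4 : K) ≠ 0 from left_ne_zero_of_mul h4]

end FixedPoints

section Counting

open scoped Classical in
/-- Counting the points of `X` with nontrivial stabilizer modulo `Z`, when every element outside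
`Z` has one or two fixed points according to the predicate `U`. -/
lemma exists_orbit_representatives {G X : Type*} [Group G] [Finite G] [MulAction G X]
    (Z U : G → Prop) (hZ : ∀ g h, Z (h⁻¹ * g * h) ↔ Z g) (hU : ∀ g h, U (h⁻¹ * g * h) ↔ U g)
    (h1 : ∀ g, ¬ Z g → U g → {x : X | g • x = x}.ncard = 1)
    (h2 : ∀ g, ¬ Z g → ¬ U g → {x : X | g • x = x}.ncard = 2) :
    ∃ s : Finset X, (∀ x ∈ s, ∃ g : G, ¬ Z g ∧ g • x = x) ∧
      (∀ g, ¬ Z g → ∃ x ∈ s, ∃ h : G, (h⁻¹ * g * h) • x = x) ∧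
      ∑ x ∈ s, Nat.card (MulAction.orbit G x) *
        ({g : G | g • x = x ∧ ¬ Z g}.ncard + {g : G | g • x = x ∧ ¬ Z g ∧ U g}.ncard) =
        2 * {g : G | ¬ Z g}.ncard := by
  have := Fintype.ofFinite G
  set c : X → ℕ := fun x =>
    ({g : G | g • x = x ∧ ¬ Z g}.ncard + {g : G | g • x = x ∧ ¬ Z g ∧ U g}.ncard) with hc
  have hfix : ∀ g, ¬ Z g → {x : X | g • x = x}.Finite ∧ {x : X | g • x = x}.Nonempty := by
    intro g hg
    have : {x : X | g • x = x}.ncard ≠ 0 := by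
      by_cases hu : U g
      · rw [h1 g hg hu]; norm_num
      · rw [h2 g hg hu]; norm_num
    exact ⟨Set.finite_of_ncard_ne_zero this, Set.nonempty_of_ncard_ne_zero this⟩
  have hfin : {x : X | ∃ g : G, ¬ Z g ∧ g • x = x}.Finite := by
    have : {x : X | ∃ g : G, ¬ Z g ∧ g • x = x} = ⋃ g ∈ {g : G | ¬ Z g}, {x : X | g • x = x} := by
      ext x; simp
    rw [this]
    exact Set.Finite.biUnion (Set.toFinite _) fun g hg => (hfix g hg).1
  set Ω := hfin.toFinset with hΩ
  have memΩ : ∀ x, x ∈ Ω ↔ ∃ g : G, ¬ Z g ∧ g • x = x := fun x => by simp [hΩ]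
  have cform : ∀ x, c x = ∑ g : G with ¬ Z g, if g • x = x then (if U g then 2 else 1) else 0 := by
    intro x
    rw [← Finset.sum_filter, Finset.filter_filter]
    have : ∀ g : G, (if U g then 2 else 1) = 1 + if U g then 1 else 0 := by
      intro g; split_ifs <;> rfl
    simp_rw [this]
    rw [Finset.sum_add_distrib, Finset.sum_ite, hc]
    simp only [Set.ncard_eq_toFinset_card', Finset.sum_const, smul_eq_mul, mul_one, mul_zero, add_zero,
      Finset.filter_filter]
    congr 2 <;> ext g <;> simp <;> tauto
  have csum : ∑ x ∈ Ω, c x = 2 * {g : G | ¬ Z g}.ncard := by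
    simp_rw [cform]
    rw [Finset.sum_comm]
    have : ∀ g ∈ (Finset.univ.filter fun g : G => ¬ Z g),
        (∑ x ∈ Ω, if g • x = x then (if U g then 2 else 1) else 0) = 2 := by
      intro g hg
      have hg : ¬ Z g := by simpa using hg
      rw [← Finset.sum_filter, Finset.sum_const]
      have : ((Ω.filter fun x => g • x = x).card) = {x : X | g • x = x}.ncard := by
        rw [← Set.ncard_coe_finset]
        congr 1
        ext x
        simp only [Finset.coe_filter, memΩ, Set.mem_ofPred_eq]
        exact ⟨fun h => h.2, fun h => ⟨⟨g, hg, h⟩, h⟩⟩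
      rw [this]
      by_cases hu : U g
      · rw [h1 g hg hu]; simp [hu]
      · rw [h2 g hg hu]; simp [hu]
    rw [Finset.sum_congr rfl this, Finset.sum_const, Set.ncard_eq_toFinset_card']
    simp [mul_comm]
  have conj : ∀ (g h : G) (x : X), g • (h • x) = h • x ↔ (h⁻¹ * g * h) • x = x := by
    intro g h x
    rw [mul_smul, mul_smul, inv_smul_eq_iff]
  have cinv : ∀ (h : G) (x : X), c (h • x) = c x := by
    intro h x
    have aux : ∀ V : G → Prop, (∀ g h, V (h⁻¹ * g * h) ↔ V g) →
        {g : G | g • h • x = h • x ∧ V g}.ncard = {g : G | g • x = x ∧ V g}.ncard := by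
      intro V hV
      refine Set.ncard_congr (fun g _ => h⁻¹ * g * h) ?_ ?_ ?_
      · rintro g ⟨hg, hg'⟩
        exact ⟨(conj _ _ _).1 hg, (hV _ _).2 hg'⟩
      · intro a b _ _ hab
        simpa using hab
      · rintro g ⟨hg, hg'⟩
        refine ⟨h * g * h⁻¹, ⟨?_, ?_⟩, by group⟩
        · rw [conj]; simpa [mul_assoc] using hg
        · rw [← hV _ h]; simpa [mul_assoc] using hg'
    simp only [hc]
    rw [aux (fun g => ¬ Z g) (fun g h => not_congr (hZ g h)),
      aux (fun g => ¬ Z g ∧ U g) (fun g h => and_congr (not_congr (hZ g h)) (hU g h))]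
  have Ωinv : ∀ (h : G) (x : X), x ∈ Ω → h • x ∈ Ω := by
    intro h x hx
    obtain ⟨g, hg, hgx⟩ := (memΩ x).1 hx
    rw [memΩ]
    refine ⟨h * g * h⁻¹, ?_, ?_⟩
    · rw [← hZ _ h]; simpa [mul_assoc] using hg
    · rw [conj]; simpa [mul_assoc] using hgx
  set rep : X → X := fun x => (Quotient.mk (MulAction.orbitRel G X) x).out with hrep
  have rep_orbit : ∀ x, ∃ h : G, h • rep x = x := by
    intro x
    have : (MulAction.orbitRel G X).r (rep x) x := Quotient.mk_out (s := MulAction.orbitRel G X) x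
    obtain ⟨h, hh⟩ := this
    exact ⟨h⁻¹, by rw [inv_smul_eq_iff]; exact hh.symm⟩
  have rep_smul : ∀ (h : G) x, rep (h • x) = rep x := by
    intro h x
    simp only [hrep]
    congr 1
    exact Quotient.sound (s := MulAction.orbitRel G X) ⟨h, rfl⟩
  have repΩ : ∀ x ∈ Ω, rep x ∈ Ω := by
    intro x hx
    obtain ⟨h, hh⟩ := rep_orbit x
    rw [← inv_smul_eq_iff.2 hh.symm]
    exact Ωinv _ _ hx
  refine ⟨Ω.image rep, ?_, ?_, ?_⟩
  · intro x hx
    obtain ⟨y, hy, rfl⟩ := Finset.mem_image.1 hx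
    exact (memΩ _).1 (repΩ y hy)
  · intro g hg
    obtain ⟨x, hx⟩ := (hfix g hg).2
    have hxΩ : x ∈ Ω := (memΩ x).2 ⟨g, hg, hx⟩
    obtain ⟨h, hh⟩ := rep_orbit x
    refine ⟨rep x, Finset.mem_image_of_mem _ hxΩ, h, ?_⟩
    rw [← conj, hh]
    exact hx
  · rw [← csum, ← Finset.sum_fiberwise_of_maps_to (g := rep) (t := Ω.image rep)
      (fun x hx => Finset.mem_image_of_mem _ hx)]
    refine Finset.sum_congr rfl fun y hy => ?_
    obtain ⟨x, hx, rfl⟩ := Finset.mem_image.1 hy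
    have h3 : ∀ z ∈ Ω.filter (fun z => rep z = rep x), c z = c (rep x) := by
      intro z hz
      obtain ⟨h, hh⟩ := rep_orbit z
      rw [← hh, cinv, (Finset.mem_filter.1 hz).2]
    rw [Finset.sum_congr rfl h3, Finset.sum_const, smul_eq_mul]
    congr 1
    rw [Nat.card_coe_set_eq, ← Set.ncard_coe_finset]
    congr 1
    ext z
    simp only [Finset.coe_filter, Set.mem_ofPred_eq]
    constructor
    · rintro ⟨h, rfl⟩
      have : rep (rep x) = rep x := by
        obtain ⟨k, hk⟩ := rep_orbit x
        conv_rhs => rw [← hk]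
        rw [rep_smul]
      exact ⟨Ωinv _ _ (repΩ x hx), by simp only [rep_smul, this]⟩
    · rintro ⟨-, hz⟩
      obtain ⟨h, hh⟩ := rep_orbit z
      exact ⟨h, by simp only [← hz]; exact hh⟩

end Counting

section Borel

variable {F : Type*} [Field F]

@[simp] lemma up_zero_zero (t : F) : (up t).1 0 0 = 1 := rfl
@[simp] lemma up_zero_one (t : F) : (up t).1 0 1 = t := rfl
@[simp] lemma up_one_zero (t : F) : (up t).1 1 0 = 0 := rfl
@[simp] lemma up_one_one (t : F) : (up t).1 1 1 = 1 := rfl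
@[simp] lemma lo_zero_zero (t : F) : (lo t).1 0 0 = 1 := rfl
@[simp] lemma lo_zero_one (t : F) : (lo t).1 0 1 = 0 := rfl
@[simp] lemma lo_one_zero (t : F) : (lo t).1 1 0 = t := rfl
@[simp] lemma lo_one_one (t : F) : (lo t).1 1 1 = 1 := rfl

lemma up_add (a b : F) : up (a + b) = up a * up b := by
  apply sl_ext <;> simp; ring

lemma up_zero : up (0 : F) = 1 := by apply sl_ext <;> simp

lemma up_neg (a : F) : up (-a) = (up a)⁻¹ := by
  apply sl_ext <;> simp

lemma lo_add (a b : F) : lo (a + b) = lo a * lo b := by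
  apply sl_ext <;> simp

lemma isPM_up {a : F} : IsPM (up a) ↔ a = 0 := by simp [isPM_iff]

/-- The translations contained in a subgroup of `SL(2, F)`. -/
def translations (B : Subgroup SL(2, F)) : AddSubgroup F where
  carrier := {a | up a ∈ B}
  zero_mem' := by simp [up_zero, B.one_mem]
  add_mem' := by
    intro a b ha hb
    simp only [Set.mem_ofPred_eq, up_add] at *
    exact B.mul_mem ha hb
  neg_mem' := by
    intro a ha
    simp only [Set.mem_ofPred_eq, up_neg] at *
    exact B.inv_mem ha

@[simp] lemma mem_translations {B : Subgroup SL(2, F)} {a : F} :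
    a ∈ translations B ↔ up a ∈ B := Iff.rfl

/-- The diagonal character of a group of upper triangular matrices. -/
def diagChar (B : Subgroup SL(2, F)) (hB : ∀ g ∈ B, g.1 1 0 = 0) : B →* Fˣ where
  toFun g := ⟨g.1.1 0 0, g.1.1 1 1, by have := det_eq g.1; rw [hB _ g.2] at this; simpa using this,
    by have := det_eq g.1; rw [hB _ g.2] at this; rw [mul_comm]; simpa using this⟩
  map_one' := by ext; simp
  map_mul' g h := by ext; simp [hB _ h.2]

lemma diagChar_val {B : Subgroup SL(2, F)} (hB : ∀ g ∈ B, g.1 1 0 = 0) (g : B) :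
    (diagChar B hB g : F) = g.1.1 0 0 := rfl

lemma tr_eq_diagChar {B : Subgroup SL(2, F)} (hB : ∀ g ∈ B, g.1 1 0 = 0) (g : B) :
    tr g.1 = (diagChar B hB g : F) + ((diagChar B hB g)⁻¹ : Fˣ) := rfl

variable [Finite F] {B : Subgroup SL(2, F)} (hB : ∀ g ∈ B, g.1 1 0 = 0)

include hB

omit [Finite F] in
lemma card_diagChar_ker : Nat.card (diagChar B hB).ker = Nat.card (translations B) := by
  symm
  refine Nat.card_eq_of_bijective
    (fun a : translations B => (⟨⟨up a.1, a.2⟩, ?_⟩ : (diagChar B hB).ker)) ⟨?_, ?_⟩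
  · rw [MonoidHom.mem_ker]
    ext
    simp [diagChar_val]
  · intro a b h
    have := congrArg (fun g : (diagChar B hB).ker => g.1.1.1 0 1) h
    exact Subtype.ext (by simpa using this)
  · rintro ⟨⟨g, hg⟩, hk⟩
    rw [MonoidHom.mem_ker] at hk
    have h1 : g.1 0 0 = 1 := congrArg Units.val hk
    have h2 : g = up (g.1 0 1) := by
      have := det_eq g
      have h0 := hB g hg
      apply sl_ext
      · simpa using h1
      · simp
      · simpa using h0
      · simp only [up_one_one]; rw [h0, h1] at this; simpa using this
    exact ⟨⟨g.1 0 1, by rw [mem_translations, ← h2]; exact hg⟩, by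
      apply Subtype.ext; apply Subtype.ext; exact h2.symm⟩

omit [Finite F] in
lemma card_upper : Nat.card B = Nat.card (translations B) * Nat.card (diagChar B hB).range := by
  rw [← card_diagChar_ker hB, ← Subgroup.index_ker, Subgroup.card_mul_index]

lemma card_upper_parabolic (h2 : (2 : F) ≠ 0) (hneg : -1 ∈ B) :
    {g : SL(2, F) | g ∈ B ∧ tr g ^ 2 = 4}.ncard = 2 * Nat.card (translations B) := by
  have h1 : {g : SL(2, F) | g ∈ B ∧ tr g ^ 2 = 4} =
      (up '' (translations B)) ∪ ((fun a => -up a) '' (translations B)) := by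
    ext g
    simp only [Set.mem_ofPred_eq, Set.mem_union, Set.mem_image, SetLike.mem_coe, mem_translations]
    constructor
    · rintro ⟨hg, ht⟩
      have hd := det_eq g
      have h0 := hB g hg
      rw [h0, mul_zero, sub_zero] at hd
      have h3 : (g.1 0 0 - g.1 1 1) ^ 2 = 0 := by rw [tr] at ht; linear_combination ht - 4 * hd
      have h4 : g.1 0 0 = g.1 1 1 := sub_eq_zero.1 (pow_eq_zero_iff (two_ne_zero) |>.1 h3)
      have h5 : (g.1 1 1 - 1) * (g.1 1 1 + 1) = 0 := by rw [h4] at hd; linear_combination hd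
      rcases mul_eq_zero.1 h5 with h | h
      · left
        have : up (g.1 0 1) = g := by
          apply sl_ext <;> simp <;> grind
        exact ⟨g.1 0 1, by rwa [this], this⟩
      · right
        have : -up (-g.1 0 1) = g := by
          apply sl_ext <;> simp <;> grind
        refine ⟨-g.1 0 1, ?_, this⟩
        have h6 : up (-g.1 0 1) = -1 * g := by conv_rhs => rw [← this]
                                               simp
        rw [h6]
        exact B.mul_mem hneg hg
    · rintro (⟨a, ha, rfl⟩ | ⟨a, ha, rfl⟩)
      · exact ⟨ha, by simp [tr]; norm_num⟩
      · refine ⟨?_, by simp [tr]; norm_num⟩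
        have : -up a = -1 * up a := by simp
        rw [this]
        exact B.mul_mem hneg ha
  have inj : Function.Injective (up : F → SL(2, F)) := by
    intro a b h
    simpa using congrArg (fun g : SL(2, F) => g.1 0 1) h
  rw [h1, Set.ncard_union_eq, Set.ncard_image_of_injective _ inj, Set.ncard_image_of_injective,
    two_mul]
  · rfl
  · exact fun a b h => inj (neg_injective h)
  · rw [Set.disjoint_left]
    rintro g ⟨a, -, rfl⟩ ⟨b, -, hb⟩
    have := congrArg (fun g : SL(2, F) => g.1 0 0) hb
    simp at this
    exact h2 (by linear_combination -this)

omit [Finite F] in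
lemma sq_mul_mem_translations (g : B) {a : F} (ha : a ∈ translations B) :
    (diagChar B hB g : F) ^ 2 * a ∈ translations B := by
  have : up ((diagChar B hB g : F) ^ 2 * a) = g.1 * up a * (g.1)⁻¹ := by
    have hd := det_eq g.1
    have h0 := hB _ g.2
    rw [diagChar_val]
    apply sl_ext <;> simp [h0] <;> grind
  rw [mem_translations, this]
  exact B.mul_mem (B.mul_mem g.2 ha) (B.inv_mem g.2)

lemma diagChar_pow {p : ℕ} [Fact p.Prime] [CharP F p] (hS : Nat.card (translations B) = p)
    (g : B) : (diagChar B hB g : F) ^ (2 * (p - 1)) = 1 := by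
  have hp : p.Prime := Fact.out
  have : Nontrivial (translations B) := by
    rw [← Finite.one_lt_card_iff_nontrivial, hS]; exact hp.one_lt
  obtain ⟨a, ha⟩ := exists_ne (0 : translations B)
  have h1 : a ∈ AddSubgroup.zmultiples a := AddSubgroup.mem_zmultiples a
  have h2 : (⟨_, sq_mul_mem_translations hB g a.2⟩ : translations B) ∈ AddSubgroup.zmultiples a :=
    mem_zmultiples_of_prime_card hS ha
  obtain ⟨k, hk⟩ := AddSubgroup.mem_zmultiples_iff.1 h2
  have ha' : (a : F) ≠ 0 := fun h => ha (Subtype.ext h)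
  have hk' : (k : F) = (diagChar B hB g : F) ^ 2 := by
    have := congrArg Subtype.val hk
    simp only [AddSubgroup.coe_zsmul, zsmul_eq_mul] at this
    exact mul_right_cancel₀ ha' this
  have hk0 : (k : F) ≠ 0 := by rw [hk']; simp
  rw [pow_mul, ← hk']
  have h3 : (k : F) ^ p = k := by
    have := map_intCast (frobenius F p) k
    rwa [frobenius_def] at this
  apply mul_right_cancel₀ hk0
  rw [one_mul, ← pow_succ, Nat.sub_add_cancel hp.one_le, h3]

lemma card_diagChar_range (h2 : (2 : F) ≠ 0) (hneg : -1 ∈ B) {p : ℕ} [Fact p.Prime] :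
    ∃ t, 0 < t ∧ Nat.card (diagChar B hB).range = 2 * t ∧
      (CharP F p → Nat.card (translations B) = p → t ∣ p - 1) := by
  have h1 : 2 ∣ Nat.card (diagChar B hB).range := by
    have hm : (-1 : Fˣ) ∈ (diagChar B hB).range := ⟨⟨-1, hneg⟩, by ext; simp [diagChar_val]⟩
    have h3 : orderOf (⟨-1, hm⟩ : (diagChar B hB).range) = 2 := by
      rw [Subgroup.orderOf_mk]
      apply orderOf_eq_prime
      · simp
      · intro h
        have := congrArg Units.val h
        simp at this
        exact h2 (by linear_combination -this)
    have h4 := orderOf_dvd_natCard (⟨-1, hm⟩ : (diagChar B hB).range)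
    rwa [h3] at h4
  obtain ⟨t, ht⟩ := h1
  refine ⟨t, ?_, ht, ?_⟩
  · have : 0 < Nat.card (diagChar B hB).range := Nat.card_pos
    omega
  · intro _ hS
    have h4 : Nat.card (diagChar B hB).range ∣ 2 * (p - 1) := by
      rw [← IsCyclic.exponent_eq_card]
      apply Monoid.exponent_dvd_of_forall_pow_eq_one
      rintro ⟨_, g, rfl⟩
      apply Subtype.ext
      apply Units.ext
      simpa using diagChar_pow hB hS g
    rw [ht] at h4
    exact Nat.dvd_of_mul_dvd_mul_left (by norm_num) h4

end Borel

section Stabilizers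

variable {F : Type*} [Field F] {K : Type*} [Field K] [DecidableEq K] [Algebra F K]

open OnePoint MulAction

lemma isPM_of_sq_eq_one (h2 : (2 : F) ≠ 0) {g : SL(2, F)} (h : g ^ 2 = 1) : IsPM g := by
  by_contra hg
  have ht := tr_eq_zero_of_sq (h ▸ isPM_one) hg
  exact one_ne_neg_one h2 (h.symm.trans (sq_eq_neg_one ht))

/-- The eigenvalue of a matrix on a fixed line. -/
def eigen (x : OnePoint K) (g : SL(2, F)) : K :=
  x.elim (algebraMap F K (g.1 0 0)) fun z => algebraMap F K (g.1 1 0) * z + algebraMap F K (g.1 1 1)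

omit [DecidableEq K] in
lemma eigen_infty (g : SL(2, F)) : eigen (∞ : OnePoint K) g = algebraMap F K (g.1 0 0) := rfl

omit [DecidableEq K] in
lemma eigen_coe (z : K) (g : SL(2, F)) : eigen (z : OnePoint K) g =
    algebraMap F K (g.1 1 0) * z + algebraMap F K (g.1 1 1) := rfl

lemma eigen_mul {x : OnePoint K} {g h : SL(2, F)} (hh : h • x = x) :
    eigen x (g * h) = eigen x g * eigen x h := by
  cases x with
  | infty =>
    rw [smul_infty_iff] at hh
    simp [eigen_infty, hh]
  | coe z =>
    rw [smul_coe_iff] at hh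
    simp only [eigen_coe, mul_one_zero, mul_one_one, map_add, map_mul]
    linear_combination (-algebraMap F K (g.1 1 0)) * hh

lemma eigen_charpoly {x : OnePoint K} {g : SL(2, F)} (hg : g • x = x) :
    eigen x g ^ 2 - algebraMap F K (tr g) * eigen x g + 1 = 0 := by
  have hd := congrArg (algebraMap F K) (det_eq g)
  simp only [map_sub, map_mul, map_one] at hd
  cases x with
  | infty =>
    rw [smul_infty_iff] at hg
    simp only [eigen_infty, tr, map_add]
    rw [hg, map_zero] at hd
    linear_combination -hd
  | coe z =>
    rw [smul_coe_iff] at hg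
    simp only [eigen_coe, tr, map_add]
    linear_combination algebraMap F K (g.1 1 0) * hg - hd

/-- Two matrices of orders three and five whose product has trace zero have no common fixed
point. -/
lemma not_common_fixed {A B : SL(2, F)} {τ : F} (hA : tr A = -1) (hB : tr B = τ)
    (hAB : tr (A * B) = 0) (hτ : τ ^ 2 + τ = 1) (x : OnePoint K) (h1 : A • x = x)
    (h2 : B • x = x) : False := by
  have e1 := eigen_charpoly h1
  have e2 := eigen_charpoly h2
  have e3 := eigen_charpoly (show (A * B) • x = x by rw [mul_smul, h2, h1])
  rw [eigen_mul h2, hAB] at e3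
  rw [hA] at e1
  rw [hB] at e2
  have hτ' := congrArg (algebraMap F K) hτ
  simp only [map_add, map_pow, map_one, map_neg, map_zero] at *
  generalize eigen x A = a at *
  generalize eigen x B = b at *
  generalize algebraMap F K τ = t at *
  have hb : b ^ 2 = -a := by
    linear_combination (-b ^ 2 * (a - 1)) * e1 + a * e3
  have ha0 : a ≠ 0 := by rintro rfl; simp at e1
  have h4 : t * b = 1 - a := by linear_combination -e2 + hb
  have h5 : a * (t ^ 2 - 3) = 0 := by
    linear_combination t ^ 2 * hb - (t * b + (1 - a)) * h4 - e1
  have h6 : t ^ 2 = 3 := by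
    rcases mul_eq_zero.1 h5 with h | h
    · exact absurd h ha0
    · linear_combination h
  have h7 : t = -2 := by linear_combination hτ' - h6
  rw [h7] at h6
  have : (1 : K) = 0 := by linear_combination h6
  exact one_ne_zero this

/-- A stabilizer containing a noncentral parabolic element is conjugate to a group of upper
triangular matrices containing a nontrivial translation. -/
lemma exists_smul_eq_infty (h2 : (2 : F) ≠ 0) {x : OnePoint K} {g : SL(2, F)} (hg : ¬ IsPM g)
    (ht : tr g ^ 2 = 4) (hx : g • x = x) : ∃ (P : SL(2, F)) (b : F), P • (∞ : OnePoint K) = x ∧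
      b ≠ 0 ∧ (P⁻¹ * g * P = up b ∨ P⁻¹ * g * P = -up b) := by
  have key : ∃ (P : SL(2, F)) (b : F), b ≠ 0 ∧ (P⁻¹ * g * P = up b ∨ P⁻¹ * g * P = -up b) := by
    have h : (tr g - 2) * (tr g + 2) = 0 := by linear_combination ht
    rcases mul_eq_zero.1 h with h | h
    · obtain ⟨P, b, hP⟩ := exists_conj_up (g := g) (by linear_combination h)
      refine ⟨P, b, ?_, Or.inl hP⟩
      rw [Ne, ← isPM_up, ← hP, isPM_conj']
      exact hg
    · obtain ⟨P, b, hP⟩ := exists_conj_up (g := -g) (by rw [tr_neg]; linear_combination -h)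
      refine ⟨P, b, ?_, Or.inr ?_⟩
      · rw [Ne, ← isPM_up, ← hP, isPM_conj', isPM_neg]
        exact hg
      · rw [← hP]; simp
  obtain ⟨P, b, hb, hP⟩ := key
  refine ⟨P, b, ?_, hb, hP⟩
  have h1 := fixed_ncard_of_tr_sq_eq (K := K) h2 hg ht
  obtain ⟨y, hy⟩ := Set.ncard_eq_one.1 h1
  have hxy : x = y := by rw [← Set.mem_singleton_iff, ← hy]; exact hx
  rw [hxy, ← Set.mem_singleton_iff, ← hy, Set.mem_ofPred_eq]
  have h3 : (P⁻¹ * g * P) • (∞ : OnePoint K) = ∞ := by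
    rw [smul_infty_iff]
    rcases hP with h | h <;> rw [h] <;> simp
  rw [mul_smul, mul_smul, inv_smul_eq_iff] at h3
  exact h3

variable [Finite F] {H : Subgroup SL(2, F)} (hneg : -1 ∈ H)

include hneg

omit [DecidableEq K] [Finite F] in
lemma ncard_add_two [Finite H] (h2 : (2 : F) ≠ 0) {T : Set H} (h1 : 1 ∈ T) (h3 : ⟨-1, hneg⟩ ∈ T) :
    {g | g ∈ T ∧ ¬ IsPM g.1}.ncard + 2 = T.ncard := by
  have hne : (1 : H) ≠ ⟨-1, hneg⟩ := fun h => one_ne_neg_one h2 (congrArg Subtype.val h)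
  have hpair := Set.ncard_pair hne
  refine (congrArg (_ + ·) hpair.symm).trans ?_
  rw [← Set.ncard_union_eq]
  · congr 1
    ext g
    simp only [Set.mem_union, Set.mem_ofPred_eq, Set.mem_insert_iff, Set.mem_singleton_iff]
    constructor
    · rintro (h | rfl | rfl)
      exacts [h.1, h1, h3]
    · intro hg
      by_cases h : IsPM g.1
      · right
        exact h.imp (fun h => Subtype.ext h) (fun h => Subtype.ext h)
      · exact Or.inl ⟨hg, h⟩
  · rw [Set.disjoint_left]
    rintro g ⟨-, hg⟩ (rfl | rfl)
    · exact hg isPM_one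
    · exact hg (Or.inr rfl)

/-- The structure of the stabilizer of a parabolic fixed point in a proper subgroup. -/
lemma parabolic_stabilizer {p : ℕ} [Fact p.Prime] [CharP F p] (hF : Nat.card F = p ^ 2)
    (h2 : (2 : F) ≠ 0) (htop : H ≠ ⊤) {x : OnePoint K} (hmove : ∃ h ∈ H, h • x ≠ x) {g : SL(2, F)}
    (hgH : g ∈ H) (hg : ¬ IsPM g) (ht : tr g ^ 2 = 4) (hx : g • x = x) :
    (∃ t, 0 < t ∧ t ∣ p - 1 ∧ Nat.card (stabilizer H x) = 2 * (p * t)) ∧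
      {g : H | g • x = x ∧ tr g.1 ^ 2 = 4}.ncard = 2 * p ∧
      ∀ g ∈ H, g • x = x → ∃ a : F, a ≠ 0 ∧ a ^ (2 * (p - 1)) = 1 ∧ tr g = a + a⁻¹ := by
  obtain ⟨P, b, hP, hb, hgb⟩ := exists_smul_eq_infty h2 hg ht hx
  set φ : SL(2, F) →* SL(2, F) := (MulAut.conj P⁻¹).toMonoidHom with hφ
  have hφv : ∀ g, φ g = P⁻¹ * g * P := fun g => by simp [hφ]
  have hφi : Function.Injective φ := (MulAut.conj P⁻¹).injective
  set B : Subgroup SL(2, F) := (H ⊓ stabilizer SL(2, F) x).map φ with hBdef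
  have hfix : ∀ g : SL(2, F), (φ g).1 1 0 = 0 ↔ g • x = x := by
    intro g
    rw [← smul_infty_iff (K := K), hφv, mul_smul, mul_smul, inv_smul_eq_iff, hP]
  have hB : ∀ g ∈ B, g.1 1 0 = 0 := by
    rintro _ ⟨g, ⟨-, hg⟩, rfl⟩
    exact (hfix g).2 hg
  have hnegx : (-1 : SL(2, F)) • x = x := IsPM.smul_eq (Or.inr rfl) x
  have hnegB : -1 ∈ B := ⟨-1, ⟨hneg, hnegx⟩, by rw [hφv]; simp⟩
  have hbB : up b ∈ B := by
    have h1 : φ g ∈ B := ⟨g, ⟨hgH, hx⟩, rfl⟩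
    rw [hφv] at h1
    rcases hgb with h | h
    · rwa [h] at h1
    · rw [h] at h1
      have := B.mul_mem hnegB h1
      simpa using this
  have hS : Nat.card (translations B) = p := by
    have h3 : Nat.card (translations B) ∣ p ^ 2 := hF ▸ AddSubgroup.card_addSubgroup_dvd_card _
    rw [Nat.dvd_prime_pow Fact.out] at h3
    obtain ⟨k, hk, h3⟩ := h3
    interval_cases k
    · rw [pow_zero, Nat.card_eq_one_iff_unique] at h3
      exact absurd (congrArg Subtype.val (h3.1.elim (⟨b, hbB⟩ : translations B) 0)) hb
    · simpa using h3
    · exfalso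
      have htr : translations B = ⊤ := by
        rw [← AddSubgroup.card_eq_iff_eq_top, h3, hF]
      obtain ⟨h, hhH, hh⟩ := hmove
      have h4 : H.map φ = ⊤ := by
        apply eq_top_of_up (h := φ h)
        · intro t
          have : t ∈ translations B := htr ▸ AddSubgroup.mem_top t
          obtain ⟨y, hy, hyt⟩ := this
          exact ⟨y, hy.1, hyt⟩
        · exact ⟨h, hhH, rfl⟩
        · rw [Ne, hfix]; exact hh
      apply htop
      have h5 : (H.map φ).comap φ = H := Subgroup.comap_map_eq_self_of_injective hφi H
      rw [← h5, h4, Subgroup.comap_top]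
  refine ⟨?_, ?_, ?_⟩
  · obtain ⟨t, ht0, ht, hdvd⟩ := card_diagChar_range hB h2 hnegB (p := p)
    refine ⟨t, ht0, hdvd inferInstance hS, ?_⟩
    have h6 : Nat.card (stabilizer H x) = Nat.card B := by
      refine Nat.card_eq_of_bijective (fun g => ⟨φ g.1.1, g.1.1, ⟨g.1.2, g.2⟩, rfl⟩) ⟨?_, ?_⟩
      · intro a b h
        exact Subtype.ext (Subtype.ext (hφi (congrArg Subtype.val h)))
      · rintro ⟨_, g, ⟨h1, h2⟩, rfl⟩
        exact ⟨⟨⟨g, h1⟩, h2⟩, rfl⟩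
    rw [h6, card_upper hB, hS, ht]
    ring
  · rw [← hS, ← card_upper_parabolic hB h2 hnegB]
    apply Set.ncard_congr (fun (g : H) _ => φ g.1)
    · rintro g ⟨h1, h3⟩
      refine ⟨⟨g.1, ⟨g.2, h1⟩, rfl⟩, ?_⟩
      rw [hφv, tr_conj']
      exact h3
    · intro a b _ _ h
      exact Subtype.ext (hφi h)
    · rintro _ ⟨⟨g, ⟨h1, h3⟩, rfl⟩, h4⟩
      refine ⟨⟨g, h1⟩, ⟨h3, ?_⟩, rfl⟩
      rwa [hφv, tr_conj'] at h4
  · intro g hgH hgx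
    have h7 : φ g ∈ B := ⟨g, ⟨hgH, hgx⟩, rfl⟩
    refine ⟨diagChar B hB ⟨φ g, h7⟩, Units.ne_zero _, diagChar_pow hB hS _, ?_⟩
    rw [← tr_conj' g P, ← hφv, tr_eq_diagChar hB ⟨φ g, h7⟩, Units.val_inv_eq_inv_val]

omit hneg in
/-- A stabilizer of order divisible by the characteristic contains a parabolic element. -/
lemma exists_parabolic_of_dvd {p : ℕ} [Fact p.Prime] [CharP F p] (h2 : (2 : F) ≠ 0)
    (S : Subgroup H) (hp : p ∣ Nat.card S) :
    ∃ g ∈ S, ¬ IsPM g.1 ∧ tr g.1 ^ 2 = 4 := by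
  obtain ⟨g, hg⟩ := exists_prime_orderOf_dvd_card' p hp
  have hgp : g.1.1 ^ p = 1 := by
    have := pow_orderOf_eq_one g
    rw [hg] at this
    simpa using congrArg (fun g : S => g.1.1) this
  have := Fintype.ofFinite F
  obtain ⟨n, hn, hq⟩ := FiniteField.card F p
  have htr : tr g.1.1 = 2 := by
    have h1 : g.1.1 ^ Fintype.card F = 1 := by
      rw [hq, ← Nat.succ_pred_eq_of_pos n.pos, pow_succ, mul_comm, pow_mul, hgp, one_pow]
    have h3 := FiniteField.trace_pow_card (g.1.1.1)
    have h4 : g.1.1.1 ^ Fintype.card F = 1 := congrArg Subtype.val h1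
    rw [FiniteField.pow_card, h4] at h3
    rw [tr, ← trace_fin_two, ← h3]
    simp
  refine ⟨g.1, g.2, ?_, by rw [htr]; norm_num⟩
  rintro (h | h)
  · have : g = 1 := Subtype.ext (Subtype.ext h)
    rw [this, orderOf_one] at hg
    exact (Fact.out : p.Prime).one_lt.ne hg
  · rw [h, tr_neg, tr_one] at htr
    exact h2 (by
      have : (2 : F) * 2 = 0 := by linear_combination -htr
      simpa using this)

end Stabilizers

section Arithmetic

lemma spherical_triple_aux {m₁ m₂ m₃ r₁ r₂ r₃ n : ℕ} (e₁ : m₁ * r₁ = n) (e₂ : m₂ * r₂ = n)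
    (e₃ : m₃ * r₃ = n) (h₁ : 3 ≤ m₁) (k₃ : 2 ≤ r₃) (hr : 5 ≤ r₁) (hr₂ : r₂ = 2)
    (hsum : m₁ + m₂ + m₃ = n + 2) (h5 : 5 ∣ r₁) : r₁ = 5 ∧ r₃ = 3 := by
  have lt : ∀ {m r k : ℕ}, m * r = n → n < m * k → r < k := fun e h =>
    Nat.lt_of_mul_lt_mul_left (e.trans_lt h)
  have f1 : 5 * m₁ ≤ n := by nlinarith
  subst hr₂
  have h3 : r₃ < 4 := lt e₃ (by omega)
  interval_cases r₃
  · omega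
  · have : r₁ < 6 := lt e₁ (by omega)
    omega

lemma spherical_triple {m₁ m₂ m₃ r₁ r₂ r₃ n : ℕ} (e₁ : m₁ * r₁ = n) (e₂ : m₂ * r₂ = n)
    (e₃ : m₃ * r₃ = n) (h₁ : 3 ≤ m₁) (k₂ : 2 ≤ r₂)
    (k₃ : 2 ≤ r₃) (hr : 0 < r₁) (hsum : m₁ + m₂ + m₃ = n + 2) (h5 : 5 ∣ r₁) :
    r₁ = 5 ∧ (r₂ = 2 ∨ r₂ = 3) ∧ (r₃ = 2 ∨ r₃ = 3) := by
  have h5' : 5 ≤ r₁ := Nat.le_of_dvd hr h5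
  have f1 : 5 * m₁ ≤ n := by nlinarith
  by_cases hr₂ : r₂ = 2
  · have := spherical_triple_aux e₁ e₂ e₃ h₁ k₃ h5' hr₂ hsum h5
    omega
  · have f2 : 3 * m₂ ≤ n := by
      have : 3 ≤ r₂ := by omega
      nlinarith
    have : r₃ < 3 := Nat.lt_of_mul_lt_mul_left (e₃.trans_lt (by omega : n < m₃ * 3))
    have hr₃ : r₃ = 2 := by omega
    have := spherical_triple_aux e₁ e₃ e₂ h₁ k₂ h5' hr₃ (by omega) h5
    omega

/-- Orbit data of a group without parabolic elements. -/
lemma spherical_orbits {X : Type*} {s : Finset X} {m r : X → ℕ} {n : ℕ}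
    (hmr : ∀ x ∈ s, m x * r x = n) (hr : ∀ x ∈ s, 2 ≤ r x) (hm : ∀ x ∈ s, 3 ≤ m x)
    (hsum : ∑ x ∈ s, m x * (2 * r x - 2) + 4 = 4 * n) (h5 : ∃ x ∈ s, 5 ∣ r x) :
    ∀ x ∈ s, r x = 2 ∨ r x = 3 ∨ r x = 5 := by
  classical
  have e : ∀ x ∈ s, m x * (2 * r x - 2) + 2 * m x = 2 * n := by
    intro x hx
    obtain ⟨k, hk⟩ := Nat.exists_eq_add_of_le (hr x hx)
    have := hmr x hx
    rw [hk] at this ⊢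
    rw [show 2 * (2 + k) - 2 = 2 + 2 * k by omega]
    linarith
  have e1 : ∀ x ∈ s, 2 * m x ≤ n := by
    intro x hx
    have := hmr x hx
    have := hr x hx
    nlinarith
  have hS : ∑ x ∈ s, 2 * m x + 4 * n = 2 * n * s.card + 4 := by
    have := Finset.sum_congr rfl e
    rw [Finset.sum_add_distrib, Finset.sum_const, smul_eq_mul] at this
    linarith
  have hle : ∑ x ∈ s, 2 * m x ≤ n * s.card := by
    have := Finset.sum_le_card_nsmul s (fun x => 2 * m x) n e1
    rw [smul_eq_mul] at this
    linarith
  have hge : 6 * s.card ≤ ∑ x ∈ s, 2 * m x := by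
    have := Finset.card_nsmul_le_sum s (fun x => 2 * m x) 6 (fun x hx => by have := hm x hx; omega)
    rw [smul_eq_mul] at this
    linarith
  obtain ⟨x, hx, hx5⟩ := h5
  have h0 : s.card ≠ 0 := (Finset.card_pos.2 ⟨x, hx⟩).ne'
  have hlt : s.card < 4 := by
    by_contra h
    have : 4 ≤ s.card := by omega
    nlinarith
  have hcard : s.card = 3 := by
    have : s.card = 1 ∨ s.card = 2 ∨ s.card = 3 := by omega
    rcases this with h | h | h <;> rw [h] at hS hge <;> omega
  obtain ⟨y, z, hyz, hs⟩ := Finset.card_eq_two.1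
    (show (s.erase x).card = 2 by rw [Finset.card_erase_of_mem hx, hcard])
  have hs' : s = insert x {y, z} := by rw [← hs, Finset.insert_erase hx]
  have hy : y ∈ s := by rw [hs']; simp
  have hz : z ∈ s := by rw [hs']; simp
  have hxs : x ∉ ({y, z} : Finset X) := by rw [← hs]; simp
  have hsum3 : m x + m y + m z = n + 2 := by
    rw [hcard, hs', Finset.sum_insert hxs, Finset.sum_pair hyz] at hS
    omega
  have := spherical_triple (hmr x hx) (hmr y hy) (hmr z hz) (hm x hx) (hr y hy) (hr z hz)
    (by have := hr x hx; omega) hsum3 hx5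
  intro w hw
  rw [hs'] at hw
  simp only [Finset.mem_insert, Finset.mem_singleton] at hw
  rcases hw with rfl | rfl | rfl <;> omega

lemma parabolic_pair {p m₀ m₁ r₁ t : ℕ} (hp : p.Prime) (hp3 : 3 ≤ p) (hp5 : p % 5 = 2 ∨ p % 5 = 3)
    (ht0 : 0 < t) (ht : t ∣ p - 1) (hm : 3 ≤ m₀) (hr : ¬ p ∣ r₁) (h1 : m₁ + 2 * m₀ = m₀ * p + 2)
    (h2 : m₁ * r₁ = m₀ * (p * t)) (h5 : 5 ∣ r₁ ∨ 5 ∣ p * t) : p = 3 ∧ r₁ = 5 := by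
  obtain ⟨e, he⟩ := ht
  have h5r : 5 ∣ r₁ := by
    rcases h5 with h | h
    · exact h
    · rcases (Nat.Prime.dvd_mul Nat.prime_five).1 h with h | h
      · omega
      · have : 5 ∣ p - 1 := he ▸ h.mul_right e
        omega
  have h3 : p ∣ m₁ := by
    have : p ∣ m₁ * r₁ := h2 ▸ ⟨m₀ * t, by ring⟩
    exact ((Nat.Prime.dvd_mul hp).1 this).resolve_right hr
  obtain ⟨q, hq⟩ := Nat.exists_eq_add_of_le hp3
  obtain ⟨j, hj⟩ := Nat.exists_eq_add_of_le hm
  have h4 : p ∣ m₀ - 1 := by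
    have h6 : p ∣ 2 * (m₀ - 1) := by
      have h7 : p ∣ m₀ * p - m₁ := Nat.dvd_sub (Dvd.intro_left _ rfl) h3
      rwa [show m₀ * p - m₁ = 2 * (m₀ - 1) by omega] at h7
    refine ((Nat.Prime.dvd_mul hp).1 h6).resolve_left fun h => ?_
    have := Nat.le_of_dvd (by norm_num) h
    omega
  obtain ⟨k, hk⟩ := h4
  have hm0 : m₀ = 1 + k * p := by rw [mul_comm k, ← hk]; omega
  have hk0 : 0 < k := by
    rcases Nat.eq_zero_or_pos k with rfl | h
    · simp at hm0; omega
    · exact h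
  have hm1 : m₁ = p * (1 + k * (q + 1)) := by
    rw [hm0, hq] at h1
    rw [hq]
    nlinarith
  have hmain : (1 + k * (q + 1)) * r₁ = (1 + k * p) * t := by
    apply Nat.eq_of_mul_eq_mul_left hp.pos
    rw [← mul_assoc, ← hm1, h2, hm0]
    ring
  have hD : 1 + k * (q + 1) ∣ 2 * t := by
    have h6 : 1 + k * (q + 1) ∣ k * (2 * t) := by
      have h7 : 1 + k * (q + 1) ∣ (1 + k * p) * t := ⟨r₁, hmain.symm⟩
      have h8 : (1 + k * p) * t = (1 + k * (q + 1)) * t + k * (2 * t) := by rw [hq]; ring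
      rw [h8] at h7
      exact (Nat.dvd_add_right (Dvd.intro _ rfl)).1 h7
    refine Nat.Coprime.dvd_of_dvd_mul_left ?_ h6
    simp
  have hp1 : p - 1 = q + 2 := by omega
  rw [hp1] at he
  have hte : t ≤ q + 2 := Nat.le_of_dvd (by omega) ⟨e, he⟩
  have hDle := Nat.le_of_dvd (by omega) hD
  have hk3 : k = 1 ∨ k = 2 ∨ 3 ≤ k := by omega
  rcases hk3 with rfl | rfl | hk3
  · have h9 : e * r₁ = p + 1 := by
      apply Nat.eq_of_mul_eq_mul_left ht0
      rw [← mul_assoc, ← he]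
      rw [show 1 + 1 * (q + 1) = q + 2 by ring] at hmain
      rw [hmain]
      ring
    have : 5 ∣ p + 1 := h9 ▸ h5r.mul_left e
    omega
  · obtain ⟨c, hc⟩ := hD
    have : c ≠ 0 := by rintro rfl; omega
    have : c < 2 := by
      by_contra h
      have : 2 ≤ c := by omega
      nlinarith
    have hc1 : c = 1 := by omega
    subst hc1
    omega
  · have hq0 : q = 0 ∧ k = 3 ∧ t = 2 := by
      have : 3 * (q + 1) ≤ k * (q + 1) := Nat.mul_le_mul_right _ hk3
      have hq0 : q = 0 := by omega
      subst hq0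
      have : k = 3 := by omega
      subst this
      omega
    obtain ⟨rfl, rfl, rfl⟩ := hq0
    subst hq
    omega

/-- Orbit data of a group with parabolic elements. -/
lemma parabolic_orbits {X : Type*} {s : Finset X} {m r u : X → ℕ} {n p : ℕ}
    (hp : p.Prime) (hp3 : 3 ≤ p) (hp5 : p % 5 = 2 ∨ p % 5 = 3)
    (hmr : ∀ x ∈ s, m x * r x = n) (hr : ∀ x ∈ s, 2 ≤ r x) (hm : ∀ x ∈ s, 3 ≤ m x)
    (hu : ∀ x ∈ s, (u x = 0 ∧ ¬ p ∣ r x) ∨ (u x + 2 = 2 * p ∧ ∃ t, 0 < t ∧ t ∣ p - 1 ∧ r x = p * t))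
    (hex : ∃ x ∈ s, u x ≠ 0)
    (hsum : ∑ x ∈ s, m x * (2 * r x - 2 + u x) + 4 = 4 * n) (h5 : ∃ x ∈ s, 5 ∣ r x) :
    p = 3 ∧ ∀ x ∈ s, u x ≠ 0 ∨ r x = 5 := by
  classical
  obtain ⟨x, hx, hux⟩ := hex
  obtain ⟨hux, t, ht0, ht, hrx⟩ := (hu x hx).resolve_left fun h => hux h.1
  have e : ∀ x ∈ s, m x * (2 * r x - 2 + u x) + 2 * m x = 2 * n + m x * u x := by
    intro x hx
    obtain ⟨k, hk⟩ := Nat.exists_eq_add_of_le (hr x hx)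
    have := hmr x hx
    rw [hk] at this ⊢
    rw [show 2 * (2 + k) - 2 = 2 + 2 * k by omega]
    linarith
  have e1 : ∀ x ∈ s, n ≤ m x * (2 * r x - 2 + u x) := by
    intro x hx
    have h1 := hmr x hx
    have h2 := hr x hx
    have h3 := e x hx
    have : 2 * m x ≤ n := by nlinarith
    have := Nat.zero_le (m x * u x)
    omega
  rw [← Finset.add_sum_erase s _ hx] at hsum
  have ex := e x hx
  have hmx := hm x hx
  have hmrx := hmr x hx
  have hmu : m x * u x + 2 * m x = 2 * (m x * p) := by
    rw [← mul_comm (u x), ← add_mul, hux]; ring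
  have hmp : 9 ≤ m x * p := by nlinarith
  have hmp' : m x * p ≤ n := by
    rw [← hmrx, hrx]
    exact Nat.mul_le_mul_left _ (Nat.le_mul_of_pos_right _ ht0)
  have hmp3 : 3 * m x ≤ m x * p := by nlinarith
  have hge : n * (s.erase x).card ≤ ∑ x ∈ s.erase x, m x * (2 * r x - 2 + u x) := by
    have := Finset.card_nsmul_le_sum (s.erase x) (fun x => m x * (2 * r x - 2 + u x)) n
      (fun x hx => e1 x (Finset.mem_of_mem_erase hx))
    rw [smul_eq_mul] at this
    linarith
  have hlt : (s.erase x).card < 2 := by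
    by_contra h
    have : 2 ≤ (s.erase x).card := by omega
    have : n * 2 ≤ n * (s.erase x).card := Nat.mul_le_mul_left _ this
    omega
  have h01 : (s.erase x).card = 0 ∨ (s.erase x).card = 1 := by omega
  rcases h01 with h0 | h1
  · exfalso
    rw [Finset.card_eq_zero.1 h0, Finset.sum_empty] at hsum
    obtain rfl | ht2 : t = 1 ∨ 2 ≤ t := by omega
    · rw [hrx, mul_one] at hmrx
      omega
    · have : m x * p * 2 ≤ m x * p * t := Nat.mul_le_mul_left _ ht2
      have h8 : m x * p * t = n := by rw [mul_assoc, ← hrx, hmrx]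
      omega
  · obtain ⟨y, hy⟩ := Finset.card_eq_one.1 h1
    have hys : y ∈ s := by
      apply Finset.mem_of_mem_erase (a := x); rw [hy]; simp
    rw [hy, Finset.sum_singleton] at hsum
    have ey := e y hys
    have hs' : s = {x, y} := by rw [← Finset.insert_erase hx, hy]
    rcases hu y hys with ⟨huy, hry⟩ | ⟨huy, t', ht', -, hry⟩
    · rw [huy] at ey hsum
      have h3 : m y + 2 * m x = m x * p + 2 := by
        simp only [mul_zero, add_zero] at ey hsum
        omega
      have h5' : 5 ∣ r y ∨ 5 ∣ p * t := by
        obtain ⟨z, hz, hz5⟩ := h5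
        rw [hs'] at hz
        simp only [Finset.mem_insert, Finset.mem_singleton] at hz
        rcases hz with rfl | rfl
        · right; rwa [← hrx]
        · left; exact hz5
      obtain ⟨h6, h7⟩ := parabolic_pair hp hp3 hp5 ht0 ht hmx hry h3
        (by rw [hmr y hys, ← hrx, hmrx]) h5'
      refine ⟨h6, fun z hz => ?_⟩
      rw [hs'] at hz
      simp only [Finset.mem_insert, Finset.mem_singleton] at hz
      rcases hz with rfl | rfl
      · left; omega
      · right; exact h7
    · exfalso
      have : 2 * m y ≤ 2 * n + m y * u y := by
        have h1 := hmr y hys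
        have h2 := hr y hys
        nlinarith
      have hy2 : m y * u y + 2 * m y = m y * (2 * p) := by
        rw [← mul_comm (u y), ← add_mul, huy]; ring
      have : 6 * m y ≤ m y * (2 * p) := by nlinarith
      omega

end Arithmetic

section Surjectivity

open MulAction

variable {F : Type*} [Field F]

/-- The trace of `A * C` is not the trace of an element of order at most three or five. -/
lemma false_of_spherical_trace {p : ℕ} [Fact p.Prime] [CharP F p] (hp2 : p ≠ 2) (hp3 : p ≠ 3)
    (hp5 : p % 5 = 2 ∨ p % 5 = 3) {τ x : F} (hτ : τ ^ 2 + τ = 1) (hx : x ^ 2 - x = 1 + τ)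
    (h : x ^ 2 = 4 ∨ x = 0 ∨ x ^ 2 = 1 ∨ x ^ 4 - 3 * x ^ 2 + 1 = 0) : False := by
  have hp : p.Prime := Fact.out
  have hq : ∀ q : ℕ, q.Prime → p ≠ q → (q : F) ≠ 0 := fun q hq hne => by
    rw [Ne, CharP.cast_eq_zero_iff F p, Nat.prime_dvd_prime_iff_eq hp hq]
    exact hne
  have h2 : (2 : F) ≠ 0 := by exact_mod_cast hq 2 Nat.prime_two hp2
  have h3 : (3 : F) ≠ 0 := by exact_mod_cast hq 3 Nat.prime_three hp3
  have h29 : (29 : F) ≠ 0 := by exact_mod_cast hq 29 (by norm_num) (by omega)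
  have h1 : (1 : F) ≠ 0 := one_ne_zero
  rcases h with h | h | h | h
  · have : (x - 2) * (x + 2) = 0 := by linear_combination h
    rcases mul_eq_zero.1 this with h | h
    · have : x = 2 := by linear_combination h
      subst this
      grind
    · have : x = -2 := by linear_combination h
      subst this
      have : τ = 5 := by linear_combination -hx
      subst this
      exact h29 (by linear_combination hτ)
  · subst h
    grind
  · have : (x - 1) * (x + 1) = 0 := by linear_combination h
    rcases mul_eq_zero.1 this with h | h
    · have : x = 1 := by linear_combination h
      subst this
      grind
    · have : x = -1 := by linear_combination h
      subst this
      grind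
  · have : (x ^ 2 - x - 1) * (x ^ 2 + x - 1) = 0 := by linear_combination h
    rcases mul_eq_zero.1 this with h | h
    · have : τ = 0 := by linear_combination h - hx
      subst this
      simp at hτ
    · have e1 : τ = -2 * x := by linear_combination h - hx
      subst e1
      have e2 : 3 * (1 - 2 * x) = 0 := by linear_combination hτ - 4 * h
      have e3 : 1 - 2 * x = 0 := (mul_eq_zero.1 e2).resolve_left h3
      exact h1 (by linear_combination -4 * h - (2 * x + 3) * e3)

lemma false_of_char_three_trace [CharP F 3] {τ x : F} (hτ : τ ^ 2 + τ = 1)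
    (hx : x ^ 2 - x = 1 + τ) (h1 : x = 0 ∨ x ^ 2 = 1 ∨ x ^ 4 = -1)
    (h2 : 1 - x = 0 ∨ (1 - x) ^ 2 = 1 ∨ (1 - x) ^ 4 = -1) : False := by
  have h3 : (3 : F) = 0 := by exact_mod_cast CharP.cast_eq_zero F 3
  have key : ∀ x : F, x ^ 2 - x = 1 + τ → (x = 0 ∨ x ^ 2 = 1 ∨ x ^ 4 = -1) → x = τ := by
    intro x hx h
    have h1 : (1 : F) ≠ 0 := one_ne_zero
    rcases h with h | h | h
    · subst h
      exfalso
      grind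
    · have : (x - 1) * (x + 1) = 0 := by linear_combination h
      exfalso
      rcases mul_eq_zero.1 this with h | h
      · have : x = 1 := by linear_combination h
        subst this
        grind
      · have : x = -1 := by linear_combination h
        subst this
        grind
    · have e1 : x ^ 4 = -τ * (x + 1) := by grind
      have e2 : τ * (x + 1) = 1 := by grind
      grind
  have e1 := key x hx h1
  have e2 := key (1 - x) (by linear_combination hx) h2
  have h1 : (1 : F) ≠ 0 := one_ne_zero
  grind

lemma isPM_sq_or {g : SL(2, F)} (h2 : (2 : F) ≠ 0) {r : ℕ} (hr : r = 2 ∨ r = 3 ∨ r = 5)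
    (h : g ^ (2 * r) = 1) :
    tr g ^ 2 = 4 ∨ tr g = 0 ∨ tr g ^ 2 = 1 ∨ tr g ^ 4 - 3 * tr g ^ 2 + 1 = 0 := by
  by_cases hg : IsPM g
  · exact Or.inl hg.tr_sq
  · have h1 : IsPM (g ^ r) := isPM_of_sq_eq_one h2 (by rw [← pow_mul, mul_comm, h])
    rcases hr with rfl | rfl | rfl
    · exact Or.inr (Or.inl (tr_eq_zero_of_sq h1 hg))
    · exact Or.inr (Or.inr (Or.inl (tr_sq_of_cube h1 hg)))
    · exact Or.inr (Or.inr (Or.inr (tr_of_pow_five h1 hg)))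

/-- A subgroup of `SL(2, F)`, `F` of order `p ^ 2`, containing a suitable triple of matrices is the
whole group. -/
theorem eq_top_of_traces [Finite F] {p : ℕ} [Fact p.Prime] [CharP F p] (hp2 : p ≠ 2)
    (hp5 : p % 5 = 2 ∨ p % 5 = 3) (hF : Nat.card F = p ^ 2) {H : Subgroup SL(2, F)} (hneg : -1 ∈ H)
    {A B C : SL(2, F)} (hA : A ∈ H) (hB : B ∈ H) (hC : C ∈ H) {τ x : F} (tA : tr A = -1)
    (tB : tr B = τ) (tC : tr C = -1) (tAB : tr (A * B) = 0) (tAC : tr (A * C) = x)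
    (hτ : τ ^ 2 + τ = 1) (hx : x ^ 2 - x = 1 + τ) : H = ⊤ := by
  classical
  by_contra htop
  have hp : p.Prime := Fact.out
  have hp3 : 3 ≤ p := by have := hp.two_le; omega
  have h2 : (2 : F) ≠ 0 := by
    have : ((2 : ℕ) : F) ≠ 0 := by
      rw [Ne, CharP.cast_eq_zero_iff F p, Nat.prime_dvd_prime_iff_eq hp Nat.prime_two]
      exact hp2
    exact_mod_cast this
  have hA3 : A ^ 3 = 1 := cube_eq_one tA
  have hB5 : B ^ 5 = 1 := pow_five_eq_one (by rw [tB]; linear_combination hτ)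
  have hBpm : ¬ IsPM B := by
    rintro (rfl | rfl)
    · simp [tA] at tAB
    · simp [tA] at tAB
  have tA'C : tr (A⁻¹ * C) = 1 - x := by
    rw [← tAC]
    have : 1 = tr A * tr C := by rw [tA, tC]; ring
    rw [this]
    simp only [tr, mul_zero_zero, mul_one_one, inv_zero_zero, inv_zero_one, inv_one_zero,
      inv_one_one]
    ring
  let K := AlgebraicClosure F
  have hfixA : ∀ y : OnePoint K, A ^ 2 • y = y → A • y = y := by
    intro y hy
    have : A = A ^ 2 * A ^ 2 := by rw [← pow_add, pow_succ, hA3, one_mul]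
    rw [this, mul_smul, hy, hy]
  have hfixB : ∀ y : OnePoint K, B ^ 2 • y = y → B • y = y := by
    intro y hy
    have : B = B ^ 2 * (B ^ 2 * B ^ 2) := by rw [← pow_add, ← pow_add, pow_succ, hB5, one_mul]
    rw [this, mul_smul, mul_smul, hy, hy, hy]
  have hnofix : ∀ y : OnePoint K, A • y = y → B • y = y → False :=
    fun y => not_common_fixed tA tB tAB hτ y
  obtain ⟨s, hs1, hs2, hs3⟩ := exists_orbit_representatives (G := H) (X := OnePoint K)
    (fun g => IsPM g.1) (fun g => tr g.1 ^ 2 = 4) (fun g h => isPM_conj')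
    (fun g h => by simp only [Subgroup.coe_mul, Subgroup.coe_inv, tr_conj'])
    (fun g hg ht => fixed_ncard_of_tr_sq_eq h2 hg ht)
    (fun g hg ht => fixed_ncard_of_tr_sq_ne h2 ht)
  have hnegfix : ∀ y : OnePoint K, (⟨-1, hneg⟩ : H) ∈ stabilizer H y :=
    fun y => IsPM.smul_eq (Or.inr rfl) y
  have hordneg : orderOf (⟨-1, hneg⟩ : H) = 2 := by
    rw [Subgroup.orderOf_mk]
    apply orderOf_eq_prime
    · simp
    · exact fun h => one_ne_neg_one h2 h.symm
  have hr : ∀ y : OnePoint K, ∃ r, Nat.card (stabilizer H y) = 2 * r := by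
    intro y
    have := (stabilizer H y).orderOf_dvd_natCard (hnegfix y)
    rwa [hordneg] at this
  choose r hr using hr
  obtain ⟨n, hn⟩ : ∃ n, Nat.card H = 2 * n := by
    have := orderOf_dvd_natCard (⟨-1, hneg⟩ : H)
    rwa [hordneg] at this
  set m : OnePoint K → ℕ := fun y => Nat.card (orbit H y) with hm
  have hmi : ∀ y, m y = (stabilizer H y).index := fun y => by
    rw [index_stabilizer, hm]; rfl
  have hmr : ∀ y, m y * r y = n := by
    intro y
    have := (stabilizer H y).card_mul_index
    rw [hr, hn, ← hmi] at this
    linarith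
  have hn0 : 0 < n := by
    have : 0 < Nat.card H := Nat.card_pos
    omega
  have hm3 : ∀ y, 3 ≤ m y := by
    intro y
    by_contra hlt
    have h0 : m y ≠ 0 := by
      intro h
      have := hmr y
      rw [h, zero_mul] at this
      omega
    have hsq : ∀ g : H, g ^ 2 ∈ stabilizer H y := by
      intro g
      have h12 : m y = 1 ∨ m y = 2 := by omega
      rw [hmi] at h12
      rcases h12 with h | h
      · rw [Subgroup.index_eq_one.1 h]; trivial
      · exact Subgroup.sq_mem_of_index_two h g
    exact hnofix y (hfixA y (hsq ⟨A, hA⟩)) (hfixB y (hsq ⟨B, hB⟩))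
  have hmove : ∀ y : OnePoint K, ∃ h ∈ H, h • y ≠ y := by
    intro y
    by_contra! h
    exact hnofix y (h A hA) (h B hB)
  have hc1 : ∀ y, {g : H | g • y = y ∧ ¬ IsPM g.1}.ncard + 2 = 2 * r y := by
    intro y
    have := ncard_add_two hneg h2 (T := (stabilizer H y : Set H)) (one_mem _) (hnegfix y)
    rw [← hr]
    exact this
  have hc2 : {g : H | ¬ IsPM g.1}.ncard + 2 = 2 * n := by
    have := ncard_add_two hneg h2 (T := Set.univ) trivial trivial
    simp only [Set.mem_univ, true_and, Set.ncard_univ] at this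
    rw [this, hn]
  set u : OnePoint K → ℕ := fun y => {g : H | g • y = y ∧ ¬ IsPM g.1 ∧ tr g.1 ^ 2 = 4}.ncard with hu
  have hu2 : ∀ y, u y + 2 = {g : H | g • y = y ∧ tr g.1 ^ 2 = 4}.ncard := by
    intro y
    rw [← ncard_add_two hneg h2 (T := {g : H | g • y = y ∧ tr g.1 ^ 2 = 4})
      ⟨one_smul _ _, (isPM_one (F := F)).tr_sq⟩ ⟨hnegfix y, IsPM.tr_sq (Or.inr rfl)⟩, hu]
    simp only [Set.mem_ofPred_eq, and_assoc, and_comm (a := ¬ IsPM _)]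
  have hsum : ∑ y ∈ s, m y * (2 * r y - 2 + u y) + 4 = 4 * n := by
    rw [show 4 * n = 2 * ({g : H | ¬ IsPM g.1}.ncard + 2) by omega, mul_add, ← hs3]
    congr 1
    apply Finset.sum_congr rfl
    intro y _
    rw [← hc1 y, Nat.add_sub_cancel]
  have hr2 : ∀ y ∈ s, 2 ≤ r y := by
    intro y hy
    obtain ⟨g, hg, hgy⟩ := hs1 y hy
    have : 0 < {g : H | g • y = y ∧ ¬ IsPM g.1}.ncard := by
      rw [Set.ncard_pos]
      exact ⟨g, hgy, hg⟩
    have := hc1 y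
    omega
  have hs5 : ∃ y ∈ s, 5 ∣ r y := by
    obtain ⟨y, hy, h, hh⟩ := hs2 ⟨B, hB⟩ hBpm
    refine ⟨y, hy, ?_⟩
    have h5 : orderOf (h⁻¹ * (⟨B, hB⟩ : H) * h) = 5 := by
      have := Fact.mk Nat.prime_five
      apply orderOf_eq_prime
      · have : (h⁻¹ * (⟨B, hB⟩ : H) * h) ^ 5 = h⁻¹ * (⟨B, hB⟩ : H) ^ 5 * h := by
          simpa using conj_pow (a := h⁻¹) (b := (⟨B, hB⟩ : H)) (i := 5)
        rw [this]
        have : (⟨B, hB⟩ : H) ^ 5 = 1 := Subtype.ext hB5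
        rw [this]; simp
      · intro h1
        have : (⟨B, hB⟩ : H) = 1 := by
          have := congrArg (fun g => h * g * h⁻¹) h1
          simpa [mul_assoc] using this
        exact hBpm (Or.inl (congrArg Subtype.val this))
    have := (stabilizer H y).orderOf_dvd_natCard hh
    rw [h5, hr] at this
    exact (Nat.Prime.dvd_mul Nat.prime_five).1 this |>.resolve_left (by norm_num)
  have hconj : ∀ g ∈ H, ¬ IsPM g → ∃ y ∈ s, ∃ k ∈ H, tr k = tr g ∧ k • y = y ∧
      k ^ (2 * r y) = 1 := by
    intro g hg hgpm
    obtain ⟨y, hy, h, hh⟩ := hs2 ⟨g, hg⟩ hgpm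
    refine ⟨y, hy, (h⁻¹ * (⟨g, hg⟩ : H) * h).1, (h⁻¹ * (⟨g, hg⟩ : H) * h).2, tr_conj' g h.1, hh, ?_⟩
    have h1 := pow_card_eq_one' (x := (⟨_, hh⟩ : stabilizer H y))
    rw [hr] at h1
    exact congrArg (fun g : stabilizer H y => g.1.1) h1
  have hAC : A * C ∈ H := H.mul_mem hA hC
  by_cases hpar : ∃ y ∈ s, u y ≠ 0
  · have hpardata : ∀ y, u y ≠ 0 → (∃ t, 0 < t ∧ t ∣ p - 1 ∧ Nat.card (stabilizer H y) = 2 * (p * t)) ∧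
        {g : H | g • y = y ∧ tr g.1 ^ 2 = 4}.ncard = 2 * p ∧
        ∀ g ∈ H, g • y = y → ∃ a : F, a ≠ 0 ∧ a ^ (2 * (p - 1)) = 1 ∧ tr g = a + a⁻¹ := by
      intro y hy
      obtain ⟨g, hgy, hg, ht⟩ := Set.nonempty_of_ncard_ne_zero hy
      exact parabolic_stabilizer hneg hF h2 htop (hmove y) g.2 hg ht hgy
    obtain ⟨rfl, hall⟩ := parabolic_orbits hp hp3 hp5 (fun y _ => hmr y) hr2 (fun y _ => hm3 y)
      (fun y hy => by
        by_cases huy : u y = 0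
        · left
          refine ⟨huy, fun hdvd => ?_⟩
          obtain ⟨g, hg, hgpm, ht⟩ := exists_parabolic_of_dvd h2 (stabilizer H y)
            (hr y ▸ Dvd.dvd.mul_left hdvd 2)
          have : 0 < u y := by
            rw [hu, Set.ncard_pos]
            exact ⟨g, hg, hgpm, ht⟩
          omega
        · right
          obtain ⟨⟨t, ht0, ht, hst⟩, hcard, -⟩ := hpardata y huy
          refine ⟨by rw [hu2, hcard], t, ht0, ht, ?_⟩
          rw [hr] at hst
          omega) hpar hsum hs5
    have h3 : (3 : F) = 0 := by exact_mod_cast CharP.cast_eq_zero F 3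
    have htr : ∀ g ∈ H, tr g = 0 ∨ tr g ^ 2 = 1 ∨ tr g ^ 4 = -1 := by
      intro g hg
      by_cases hgpm : IsPM g
      · right; left
        rw [hgpm.tr_sq]
        linear_combination h3
      obtain ⟨y, hy, k, hk, hkt, hky, hkr⟩ := hconj g hg hgpm
      rw [← hkt]
      rcases hall y hy with huy | hry
      · obtain ⟨a, ha0, ha, hta⟩ := (hpardata y huy).2.2 k hk hky
        rw [hta]
        have : (a ^ 2 - 1) * (a ^ 2 + 1) = 0 := by linear_combination ha
        rcases mul_eq_zero.1 this with h | h
        · right; left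
          field_simp
          grind
        · left
          field_simp
          linear_combination h
      · rcases isPM_sq_or h2 (Or.inr (Or.inr hry)) hkr with h | h | h | h
        · right; left; linear_combination h + h3
        · exact Or.inl h
        · exact Or.inr (Or.inl h)
        · right; right; linear_combination h + tr k ^ 2 * h3
    have e1 := htr (A * C) hAC
    have e2 := htr (A⁻¹ * C) (H.mul_mem (H.inv_mem hA) hC)
    rw [tAC] at e1
    rw [tA'C] at e2
    exact false_of_char_three_trace hτ hx e1 e2
  · push Not at hpar
    have hall := spherical_orbits (fun y _ => hmr y) hr2 (fun y _ => hm3 y)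
      (by rw [← hsum]; congr 1; exact Finset.sum_congr rfl fun y hy => by rw [hpar y hy, add_zero])
      hs5
    have htr : ∀ g ∈ H, tr g ^ 2 = 4 ∨ tr g = 0 ∨ tr g ^ 2 = 1 ∨
        tr g ^ 4 - 3 * tr g ^ 2 + 1 = 0 := by
      intro g hg
      by_cases hgpm : IsPM g
      · exact Or.inl hgpm.tr_sq
      obtain ⟨y, hy, k, hk, hkt, hky, hkr⟩ := hconj g hg hgpm
      rw [← hkt]
      exact isPM_sq_or h2 (hall y hy) hkr
    have hne3 : p ≠ 3 := by
      rintro rfl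
      have h3 : (3 : F) = 0 := by exact_mod_cast CharP.cast_eq_zero F 3
      have hApm : ¬ IsPM A := by
        rintro (rfl | rfl)
        · rw [one_mul, tB] at tAB
          rw [tAB] at hτ
          simp at hτ
        · simp only [neg_mul, one_mul, tr_neg, tB, neg_eq_zero] at tAB
          rw [tAB] at hτ
          simp at hτ
      obtain ⟨y, hy, h, hh⟩ := hs2 ⟨A, hA⟩ hApm
      have : 0 < u y := by
        rw [hu, Set.ncard_pos]
        refine ⟨_, hh, fun h => hApm (isPM_conj'.1 h), ?_⟩
        have : tr (h⁻¹ * (⟨A, hA⟩ : H) * h).1 = tr A := tr_conj' A h.1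
        rw [this, tA]
        linear_combination -h3
      rw [hpar y hy] at this
      exact this.false
    have e1 := htr (A * C) hAC
    rw [tAC] at e1
    exact false_of_spherical_trace hp2 hne3 hp5 hτ hx e1

end Surjectivity

section Triples

variable {F : Type*} [Field F]

/-- A pair of matrices with the traces of the images of `α` and `β`. -/
structure IsPair (τ : F) (A B : SL(2, F)) : Prop where
  rel : τ ^ 2 + τ = 1
  trA : tr A = -1
  trB : tr B = τ
  trAB : tr (A * B) = 0

/-- A triple of matrices with the traces of the images of `α`, `β` and `γ`. -/
structure IsTriple (τ x : F) (A B C : SL(2, F)) : Prop extends IsPair τ A B where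
  trC : tr C = -1
  trBC : tr (B * C) = 0
  trABC : tr (A * B * C) = 0
  trAC : tr (A * C) = x

lemma inv_val (g : SL(2, F)) : (g⁻¹).1 = tr g • 1 - g.1 := by
  ext i j
  fin_cases i <;> fin_cases j <;> simp [tr]

/-- The linear combination of `1`, `A`, `B` and `A * B` with the given coefficients. -/
def comb (A B : SL(2, F)) (a b c d : F) : Matrix (Fin 2) (Fin 2) F :=
  a • 1 + b • A.1 + c • B.1 + d • (A.1 * B.1)

lemma comb_smul (A B : SL(2, F)) (k a b c d : F) :
    k • comb A B a b c d = comb A B (k * a) (k * b) (k * c) (k * d) := by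
  simp only [comb]; module

lemma comb_add (A B : SL(2, F)) (a b c d a' b' c' d' : F) :
    comb A B a b c d + comb A B a' b' c' d' = comb A B (a + a') (b + b') (c + c') (d + d') := by
  simp only [comb]; module

lemma det_comb (A B : SL(2, F)) (a b c d : F) : (comb A B a b c d).det =
    a ^ 2 + b ^ 2 + c ^ 2 + d ^ 2 + a * b * tr A + a * c * tr B + a * d * tr (A * B)
      + b * c * (tr A * tr B - tr (A * B)) + b * d * tr B + c * d * tr A := by
  have hA := det_eq A
  have hB := det_eq B
  rw [det_fin_two]
  simp [comb, tr, mul_apply, Fin.sum_univ_two]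
  linear_combination (b ^ 2 + d ^ 2 * (B.1 0 0 * B.1 1 1 - B.1 0 1 * B.1 1 0) +
    b * d * (B.1 0 0 + B.1 1 1)) * hA + (c ^ 2 + d ^ 2 + c * d * (A.1 0 0 + A.1 1 1)) * hB

namespace IsPair

variable {τ : F} {A B : SL(2, F)} (h : IsPair τ A B)

include h

lemma mul_self_A : A.1 * A.1 = -A.1 - 1 := by
  rw [← val_mul, ← pow_two, sq_val, h.trA]; module

lemma mul_self_B : B.1 * B.1 = τ • B.1 - 1 := by
  rw [← val_mul, ← pow_two, sq_val, h.trB]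

lemma mul_swap : B.1 * A.1 = τ • 1 + τ • A.1 - B.1 - A.1 * B.1 := by
  have h1 := h.trA
  have h2 := h.trB
  have h3 := h.trAB
  simp only [tr, mul_zero_zero, mul_one_one] at h1 h2 h3
  ext i j
  fin_cases i <;> fin_cases j <;> simp [mul_apply, Fin.sum_univ_two] <;> grind

lemma B_mul_AB : B.1 * (A.1 * B.1) = 1 + A.1 := by
  rw [← mul_assoc, h.mul_swap]
  simp only [add_mul, sub_mul, smul_mul_assoc, one_mul, mul_assoc, h.mul_self_B, mul_sub, mul_one,
    mul_smul_comm]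
  module

lemma A_mul_comb (a b c d : F) :
    A.1 * comb A B a b c d = comb A B (-b) (a - b) (-d) (c - d) := by
  simp only [comb, mul_add, mul_smul_comm, ← mul_assoc, h.mul_self_A, sub_mul, neg_mul, one_mul,
    mul_one]
  module

lemma B_mul_comb (a b c d : F) : B.1 * comb A B a b c d =
    comb A B (τ * b - c + d) (τ * b + d) (a - b + τ * c) (-b) := by
  simp only [comb, mul_add, mul_smul_comm, mul_one, h.B_mul_AB, h.mul_swap, h.mul_self_B]
  module

lemma trace_comb (a b c d : F) : (comb A B a b c d).trace = 2 * a - b + τ * c := by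
  have h1 : A.1.trace = -1 := by rw [trace_fin_two]; exact h.trA
  have h2 : B.1.trace = τ := by rw [trace_fin_two]; exact h.trB
  have h3 : (A.1 * B.1).trace = 0 := by rw [trace_fin_two]; exact h.trAB
  simp only [comb, trace_add, trace_smul, h1, h2, h3, trace_one, smul_eq_mul]
  simp
  ring

lemma coeff_unique {a b c d k x : F} (h1 : 2 * a - b + τ * c = -k) (h2 : -a - b - τ * d = x)
    (h3 : τ * a + (τ ^ 2 - 2) * c + d = 0) (h4 : -τ * b + c - 2 * d = 0) :
    a = (τ - 1) * x + (1 - 2 * τ) * k ∧ b = (τ - 1) * (2 * x - k) ∧ c = (1 - 2 * τ) * k ∧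
      d = (2 * τ - 1) * (x - k) := by
  have hτ := h.rel
  have hc : c = τ * b + 2 * d := by linear_combination h4
  subst hc
  have ha : a = (1 + τ) * b + (3 + τ) * d := by grind
  subst ha
  have hb : b = (τ - 1) * k - 2 * (1 + τ) * d := by grind
  subst hb
  have hd : d = (2 * τ - 1) * (x - k) := by grind
  subst hd
  refine ⟨?_, ?_, ?_, rfl⟩ <;> grind

lemma trace_A_comb (a b c d : F) :
    (A.1 * comb A B a b c d).trace = -a - b - τ * d := by
  rw [h.A_mul_comb, h.trace_comb]; ring

lemma trace_B_comb (a b c d : F) :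
    (B.1 * comb A B a b c d).trace = τ * a + (τ ^ 2 - 2) * c + d := by
  rw [h.B_mul_comb, h.trace_comb]; ring

lemma trace_AB_comb (a b c d : F) :
    (A.1 * B.1 * comb A B a b c d).trace = -τ * b + c - 2 * d := by
  rw [mul_assoc, h.B_mul_comb, h.A_mul_comb, h.trace_comb]; ring

lemma comb_eq_zero {a b c d : F} (h0 : comb A B a b c d = 0) :
    a = 0 ∧ b = 0 ∧ c = 0 ∧ d = 0 := by
  have h1 := h.trace_comb a b c d
  have h2 := h.trace_A_comb a b c d
  have h3 := h.trace_B_comb a b c d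
  have h4 := h.trace_AB_comb a b c d
  rw [h0] at h1 h2 h3 h4
  simp only [mul_zero, trace_zero] at h1 h2 h3 h4
  have := h.coeff_unique (k := 0) (x := 0) (by rw [← h1, neg_zero]) h2.symm h3.symm h4.symm
  simpa using this

lemma comb_injective {a b c d a' b' c' d' : F} (h0 : comb A B a b c d = comb A B a' b' c' d') :
    a = a' ∧ b = b' ∧ c = c' ∧ d = d' := by
  have := h.comb_eq_zero (a := a - a') (b := b - b') (c := c - c') (d := d - d') (by
    rw [← sub_eq_zero] at h0
    rw [← h0]
    simp only [comb]; module)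
  simpa only [sub_eq_zero] using this

lemma exists_comb (M : Matrix (Fin 2) (Fin 2) F) : ∃ a b c d, M = comb A B a b c d := by
  let Φ : (Fin 4 → F) →ₗ[F] Matrix (Fin 2) (Fin 2) F :=
    { toFun := fun v => comb A B (v 0) (v 1) (v 2) (v 3)
      map_add' := fun v w => by simp only [Pi.add_apply, comb_add]
      map_smul' := fun k v => by
        simp only [Pi.smul_apply, smul_eq_mul, comb_smul, RingHom.id_apply] }
  have hinj : Function.Injective Φ := by
    rw [← LinearMap.ker_eq_bot, LinearMap.ker_eq_bot']
    intro v hv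
    obtain ⟨h1, h2, h3, h4⟩ := h.comb_eq_zero hv
    ext i
    fin_cases i <;> assumption
  have hsurj : Function.Surjective Φ :=
    (LinearMap.injective_iff_surjective_of_finrank_eq_finrank
      (by simp [Module.finrank_matrix])).1 hinj
  obtain ⟨v, hv⟩ := hsurj M
  exact ⟨_, _, _, _, hv.symm⟩

lemma isPM_iff_comb {g : SL(2, F)} {a b c d : F} (hg : g.1 = comb A B a b c d) :
    IsPM g ↔ (a = 1 ∨ a = -1) ∧ b = 0 ∧ c = 0 ∧ d = 0 := by
  have h1 : (1 : SL(2, F)).1 = comb A B 1 0 0 0 := by simp [comb]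
  have h2 : (-1 : SL(2, F)).1 = comb A B (-1) 0 0 0 := by simp [comb]
  constructor
  · rintro (rfl | rfl)
    · obtain ⟨rfl, rfl, rfl, rfl⟩ := h.comb_injective (hg.symm.trans h1)
      simp
    · obtain ⟨rfl, rfl, rfl, rfl⟩ := h.comb_injective (hg.symm.trans h2)
      simp
  · rintro ⟨rfl | rfl, rfl, rfl, rfl⟩
    · exact Or.inl (Subtype.ext (hg.trans h1.symm))
    · exact Or.inr (Subtype.ext (hg.trans h2.symm))

end IsPair

/-- The third matrix of a triple is determined by the first two and the parameters. -/
lemma IsTriple.eq_comb {τ x : F} {A B C : SL(2, F)} (h : IsTriple τ x A B C) :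
    C.1 = comb A B ((τ - 1) * x + 1 - 2 * τ) ((τ - 1) * (2 * x - 1)) (1 - 2 * τ)
      ((2 * τ - 1) * (x - 1)) := by
  obtain ⟨a, b, c, d, hC⟩ := h.exists_comb C.1
  have h1 := h.trace_comb a b c d
  have h2 := h.trace_A_comb a b c d
  have h3 := h.trace_B_comb a b c d
  have h4 := h.trace_AB_comb a b c d
  rw [← hC] at h1 h2 h3 h4
  rw [trace_fin_two] at h1 h2 h3 h4
  obtain ⟨rfl, rfl, rfl, rfl⟩ := h.coeff_unique (k := 1) (x := x)
    (h1.symm.trans h.trC) (h2.symm.trans h.trAC) (h3.symm.trans h.trBC) (h4.symm.trans h.trABC)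
  rw [hC]
  congr 1 <;> ring

lemma IsPair.det_third {τ : F} {A B : SL(2, F)} (h : IsPair τ A B) (x : F) :
    (comb A B ((τ - 1) * x + 1 - 2 * τ) ((τ - 1) * (2 * x - 1)) (1 - 2 * τ)
      ((2 * τ - 1) * (x - 1))).det = 1 + (1 - τ) * (x ^ 2 - x - 1 - τ) := by
  have hτ := h.rel
  rw [det_comb, h.trA, h.trB, h.trAB]
  grind

/-- The relation between the parameters of a triple. -/
lemma IsTriple.param_rel {τ x : F} {A B C : SL(2, F)} (h : IsTriple τ x A B C) :
    x ^ 2 - x = 1 + τ := by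
  have hτ := h.rel
  have h1 := h.det_third x
  rw [← h.eq_comb, C.2] at h1
  have h2 : (1 - τ) * (x ^ 2 - x - 1 - τ) = 0 := by linear_combination -h1
  linear_combination (2 + τ) * h2 + (x ^ 2 - x - 1 - τ) * hτ

lemma IsPair.exists_triple {τ x : F} {A B : SL(2, F)} (h : IsPair τ A B)
    (hx : x ^ 2 - x = 1 + τ) : ∃ C, IsTriple τ x A B C := by
  have hτ := h.rel
  refine ⟨⟨_, (h.det_third x).trans (by linear_combination (1 - τ) * hx)⟩, h, ?_, ?_, ?_, ?_⟩
  · refine (trace_fin_two _).symm.trans ((h.trace_comb _ _ _ _).trans ?_)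
    grind
  · refine (trace_fin_two _).symm.trans ((h.trace_B_comb _ _ _ _).trans ?_)
    grind
  · refine (trace_fin_two _).symm.trans ((h.trace_AB_comb _ _ _ _).trans ?_)
    grind
  · refine (trace_fin_two _).symm.trans ((h.trace_A_comb _ _ _ _).trans ?_)
    grind

/-- The homomorphism of the free group given by a triple. -/
def wordMap (A B C : SL(2, F)) : FreeGroup (Fin 3) →* SL(2, F) := FreeGroup.lift ![A, B, C]

/-- Triples with parameters matching under a field homomorphism satisfy the same relations. -/
lemma isPM_wordMap_iff {F' : Type*} [Field F'] (σ : F →+* F') {τ x : F} {A B C : SL(2, F)}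
    (h : IsTriple τ x A B C) {A' B' C' : SL(2, F')} (h' : IsTriple (σ τ) (σ x) A' B' C')
    (w : FreeGroup (Fin 3)) : IsPM (wordMap A B C w) ↔ IsPM (wordMap A' B' C' w) := by
  let R : Matrix (Fin 2) (Fin 2) F → Matrix (Fin 2) (Fin 2) F' → Prop := fun M M' =>
    ∃ a b c d, M = comb A B a b c d ∧ M' = comb A' B' (σ a) (σ b) (σ c) (σ d)
  have hRA : ∀ M M', R M M' → R (A.1 * M) (A'.1 * M') := by
    rintro _ _ ⟨a, b, c, d, rfl, rfl⟩
    exact ⟨_, _, _, _, h.A_mul_comb a b c d, by rw [h'.A_mul_comb]; simp⟩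
  have hRB : ∀ M M', R M M' → R (B.1 * M) (B'.1 * M') := by
    rintro _ _ ⟨a, b, c, d, rfl, rfl⟩
    exact ⟨_, _, _, _, h.B_mul_comb a b c d, by rw [h'.B_mul_comb]; simp⟩
  have hRadd : ∀ M M' N N', R M M' → R N N' → R (M + N) (M' + N') := by
    rintro _ _ _ _ ⟨a, b, c, d, rfl, rfl⟩ ⟨a', b', c', d', rfl, rfl⟩
    exact ⟨_, _, _, _, comb_add .., by rw [comb_add]; simp⟩
  have hRsmul : ∀ k M M', R M M' → R (k • M) (σ k • M') := by
    rintro k _ _ ⟨a, b, c, d, rfl, rfl⟩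
    exact ⟨_, _, _, _, comb_smul .., by rw [comb_smul]; simp⟩
  have hRC : ∀ M M', R M M' → R (C.1 * M) (C'.1 * M') := by
    intro M M' hM
    rw [h.eq_comb, h'.eq_comb]
    simp only [comb, add_mul, smul_mul_assoc, one_mul, mul_assoc]
    have := hRadd _ _ _ _ (hRadd _ _ _ _ (hRadd _ _ _ _
      (hRsmul ((τ - 1) * x + 1 - 2 * τ) _ _ hM)
      (hRsmul ((τ - 1) * (2 * x - 1)) _ _ (hRA _ _ hM)))
      (hRsmul (1 - 2 * τ) _ _ (hRB _ _ hM)))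
      (hRsmul ((2 * τ - 1) * (x - 1)) _ _ (hRA _ _ (hRB _ _ hM)))
    simpa [map_ofNat] using this
  have hRw : ∀ w : FreeGroup (Fin 3), ∀ M M', R M M' →
      R ((wordMap A B C w).1 * M) ((wordMap A' B' C' w).1 * M') := by
    have hgen : ∀ i : Fin 3, ∀ M M', R M M' →
        R ((wordMap A B C (FreeGroup.of i)).1 * M)
          ((wordMap A' B' C' (FreeGroup.of i)).1 * M') := by
      intro i
      fin_cases i <;> simpa [wordMap]
    have hinv : ∀ (g : SL(2, F)) (g' : SL(2, F')), tr g' = σ (tr g) →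
        (∀ M M', R M M' → R (g.1 * M) (g'.1 * M')) →
        ∀ M M', R M M' → R ((g⁻¹).1 * M) ((g'⁻¹).1 * M') := by
      intro g g' ht hg M M' hM
      rw [inv_val, inv_val, ht]
      have := hRadd _ _ _ _ (hRsmul (tr g) _ _ hM) (hRsmul (-1) _ _ (hg _ _ hM))
      simpa only [sub_mul, sub_eq_add_neg, smul_mul_assoc, one_mul, neg_smul, one_smul,
        map_neg, map_one, add_mul, neg_mul] using this
    intro w
    induction w using FreeGroup.induction_on with
    | C1 => simp
    | of i => exact hgen i
    | inv_of i _ =>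
      rw [map_inv, map_inv]
      refine hinv _ _ ?_ (hgen i)
      fin_cases i <;> simp [wordMap, h.trA, h'.trA, h.trB, h'.trB, h.trC, h'.trC]
    | mul v w hv hw =>
      intro M M' hM
      rw [map_mul, map_mul, val_mul, val_mul, mul_assoc, mul_assoc]
      exact hv _ _ (hw _ _ hM)
  have h1 : R 1 1 := ⟨1, 0, 0, 0, by simp [comb], by simp [comb]⟩
  obtain ⟨a, b, c, d, hw, hw'⟩ := hRw w 1 1 h1
  rw [mul_one] at hw hw'
  rw [h.isPM_iff_comb hw, h'.isPM_iff_comb hw']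
  simp only [map_eq_zero, map_eq_one_iff σ σ.injective]
  rw [← σ.injective.eq_iff (a := a) (b := -1)]
  simp

end Triples

section Existence

variable {F : Type*} [Field F]

open Polynomial in
lemma exists_isPair [Finite F] (h2 : (2 : F) ≠ 0) {τ : F} (hτ : τ ^ 2 + τ = 1) :
    ∃ A B : SL(2, F), IsPair τ A B := by
  obtain ⟨y, z, hyz⟩ : ∃ y z : F, y ^ 2 = -3 * z ^ 2 - 2 * τ * z + τ ^ 2 - 4 := by
    by_cases h3 : (3 : F) = 0
    · have h0 : τ ≠ 0 := by rintro rfl; simp at hτ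
      refine ⟨0, (τ ^ 2 - 4) / (2 * τ), ?_⟩
      rw [h3]
      field_simp
      ring
    · have := Fintype.ofFinite F
      obtain ⟨y, z, h⟩ := FiniteField.exists_root_sum_quadratic (R := F) (f := X ^ 2)
        (g := C 3 * X ^ 2 + C (2 * τ) * X + C (4 - τ ^ 2)) (degree_X_pow 2) (degree_quadratic h3)
        (FiniteField.odd_card_of_char_ne_two (fun h => h2 (by
          have : CharP F 2 := h ▸ ringChar.charP F
          exact CharTwo.two_eq_zero)))
      refine ⟨y, z, ?_⟩
      simp at h
      linear_combination h
  obtain ⟨b, hb⟩ : ∃ b, 2 * b = z + τ + y := ⟨(z + τ + y) / 2, by field_simp⟩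
  refine ⟨mat 0 (-1) 1 (-1) (by ring), mat b (z + τ - b) z (τ - b) ?_, hτ, ?_, ?_, ?_⟩
  · refine mul_left_cancel₀ (mul_ne_zero h2 h2) ?_
    linear_combination (-2 * b - y + z + τ) * hb - hyz
  all_goals simp [tr]

end Existence

section Homs

variable {F : Type*} [Field F]

lemma coe_eq_one_iff {g : SL(2, F)} :
    (g : PSL(2, F)) = 1 ↔ IsPM g := by
  rw [QuotientGroup.eq_one_iff, mem_center]

/-- The homomorphism `f` is induced by the triple `A`, `B`, `C`. -/
def Induces (A B C : SL(2, F)) (f : Tet →* PSL(2, F)) :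
    Prop :=
  ∀ w, f (PresentedGroup.mk _ w) = (wordMap A B C w : PSL(2, F))

lemma induces_of_generators {A B C : SL(2, F)}
    {f : Tet →* PSL(2, F)}
    (h : ∀ i, f (PresentedGroup.of i) =
      ((![A, B, C] i : SL(2, F)) : PSL(2, F))) :
    Induces A B C f := by
  intro w
  have : f.comp (PresentedGroup.mk tetRelators) =
      (QuotientGroup.mk' (Subgroup.center SL(2, F))).comp (wordMap A B C) := by
    ext i
    simpa [wordMap, PresentedGroup.of] using h i
  exact DFunLike.congr_fun this w

lemma Induces.mem_ker {A B C : SL(2, F)}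
    {f : Tet →* PSL(2, F)} (h : Induces A B C f)
    (w : FreeGroup (Fin 3)) : PresentedGroup.mk _ w ∈ f.ker ↔ IsPM (wordMap A B C w) := by
  rw [MonoidHom.mem_ker, h, coe_eq_one_iff]

lemma Induces.ker_eq {F' : Type*} [Field F'] {A B C : SL(2, F)} {A' B' C' : SL(2, F')}
    {f : Tet →* PSL(2, F)}
    {f' : Tet →* PSL(2, F')}
    (h : Induces A B C f) (h' : Induces A' B' C' f') (σ : F →+* F') {τ x : F}
    (ht : IsTriple τ x A B C) (ht' : IsTriple (σ τ) (σ x) A' B' C') : f.ker = f'.ker := by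
  ext g
  obtain ⟨w, rfl⟩ := PresentedGroup.mk_surjective _ g
  rw [h.mem_ker, h'.mem_ker, isPM_wordMap_iff σ ht ht']

lemma IsTriple.exists_induces {τ x : F} {A B C : SL(2, F)} (h : IsTriple τ x A B C) :
    ∃ f, Induces A B C f := by
  have hrel : ∀ r ∈ tetRelators, FreeGroup.lift (fun i => ((![A, B, C] i : SL(2, F)) :
      PSL(2, F))) r = 1 := by
    have h2 : ∀ g : SL(2, F), tr g = 0 → IsPM (g ^ 2) := fun g hg => Or.inr (sq_eq_neg_one hg)
    have hB : tr B ^ 2 + tr B - 1 = 0 := by rw [h.trB, h.rel, sub_self]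
    rintro r (rfl | rfl | rfl | rfl | rfl | rfl) <;>
      simp only [map_pow, map_mul, FreeGroup.lift_apply_of, ← QuotientGroup.mk_mul,
        ← QuotientGroup.mk_pow, coe_eq_one_iff]
    · exact Or.inl (cube_eq_one h.trA)
    · exact Or.inl (pow_five_eq_one hB)
    · exact Or.inl (cube_eq_one h.trC)
    · exact h2 _ h.trAB
    · exact h2 _ h.trBC
    · exact h2 _ h.trABC
  exact ⟨PresentedGroup.toGroup hrel, induces_of_generators fun i => PresentedGroup.toGroup.of hrel⟩

lemma IsTriple.surjective [Finite F] {p : ℕ} [Fact p.Prime] [CharP F p] (hp2 : p ≠ 2)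
    (hp5 : p % 5 = 2 ∨ p % 5 = 3) (hF : Nat.card F = p ^ 2) {τ x : F} {A B C : SL(2, F)}
    (h : IsTriple τ x A B C) {f : Tet →* PSL(2, F)}
    (hf : Induces A B C f) : Function.Surjective f := by
  have hmem : ∀ w, wordMap A B C w ∈ f.range.comap (QuotientGroup.mk' (Subgroup.center SL(2, F))) :=
    fun w => ⟨_, hf w⟩
  have hA := hmem (FreeGroup.of 0)
  have hB := hmem (FreeGroup.of 1)
  have hC := hmem (FreeGroup.of 2)
  simp only [wordMap, FreeGroup.lift_apply_of] at hA hB hC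
  have hneg : -1 ∈ f.range.comap (QuotientGroup.mk' (Subgroup.center SL(2, F))) :=
    ⟨1, (map_one f).trans (coe_eq_one_iff.2 (Or.inr rfl)).symm⟩
  have htop := eq_top_of_traces hp2 hp5 hF hneg hA hB hC h.trA h.trB h.trC h.trAB h.trAC h.rel
    h.param_rel
  intro y
  obtain ⟨g, rfl⟩ := QuotientGroup.mk_surjective y
  have : g ∈ f.range.comap (QuotientGroup.mk' (Subgroup.center SL(2, F))) := by
    rw [htop]; trivial
  exact this

lemma eq_one_of_relations {G : Type*} [Group G] {a b c : G} (ha : a ^ 3 = 1) (hb : b ^ 5 = 1)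
    (hc : c ^ 3 = 1) (hab : (a * b) ^ 2 = 1) (hbc : (b * c) ^ 2 = 1) (habc : (a * b * c) ^ 2 = 1)
    (h : a = 1 ∨ b = 1 ∨ c = 1 ∨ a * b = 1 ∨ b * c = 1 ∨ a * b * c = 1) :
    a = 1 ∧ b = 1 ∧ c = 1 := by
  have hcop : ∀ {m n : ℕ} (g : G), g ^ m = 1 → g ^ n = 1 → m.Coprime n → g = 1 := by
    intro m n g hm hn hmn
    rw [← orderOf_eq_one_iff, ← Nat.dvd_one, ← hmn]
    exact Nat.dvd_gcd (orderOf_dvd_of_pow_eq_one hm) (orderOf_dvd_of_pow_eq_one hn)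
  have hB : b = 1 → a = 1 ∧ b = 1 ∧ c = 1 := by
    rintro rfl
    rw [mul_one] at hab
    rw [one_mul] at hbc
    exact ⟨hcop a hab ha (by norm_num), rfl, hcop c hbc hc (by norm_num)⟩
  have hC : c = 1 → a = 1 ∧ b = 1 ∧ c = 1 := by
    rintro rfl
    rw [mul_one] at hbc
    exact hB (hcop b hbc hb (by norm_num))
  rcases h with rfl | h | h | h | h | h
  · rw [one_mul] at hab
    exact hB (hcop b hab hb (by norm_num))
  · exact hB h
  · exact hC h
  · obtain rfl := eq_inv_of_mul_eq_one_left h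
    rw [inv_pow, inv_eq_one] at ha
    exact hB (hcop b ha hb (by norm_num))
  · obtain rfl := eq_inv_of_mul_eq_one_left h
    rw [inv_pow, inv_eq_one] at hb
    exact hC (hcop c hc hb (by norm_num))
  · have h' := eq_inv_of_mul_eq_one_left h
    rw [h', inv_pow, inv_eq_one] at hab
    exact hC (hcop c hab hc (by norm_num))

lemma exists_lift_pow_eq_one {n : ℕ} (hn : Odd n)
    {g : PSL(2, F)} (hg : g ^ n = 1) :
    ∃ A : SL(2, F), (A : PSL(2, F)) = g ∧ A ^ n = 1 := by
  obtain ⟨A, rfl⟩ := QuotientGroup.mk_surjective g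
  rw [← QuotientGroup.mk_pow] at hg
  rcases coe_eq_one_iff.1 hg with h | h
  · exact ⟨A, rfl, h⟩
  · refine ⟨-A, ?_, by rw [hn.neg_pow, h, neg_neg]⟩
    rw [neg_eq_neg_one_mul, QuotientGroup.mk_mul, coe_eq_one_iff.2 (Or.inr rfl), one_mul]

/-- Every surjection onto `PSL(2, F)` is induced by a triple. -/
lemma exists_triple_of_surjective {f : Tet →* PSL(2, F)}
    (hf : Function.Surjective f) :
    ∃ (τ x : F) (A B C : SL(2, F)), IsTriple τ x A B C ∧ Induces A B C f := by
  have hrel : ∀ r ∈ tetRelators, f (PresentedGroup.mk _ r) = 1 := fun r hr => by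
    rw [PresentedGroup.one_of_mem hr, map_one]
  have ha := hrel _ (Or.inl rfl)
  have hb := hrel _ (Or.inr (Or.inl rfl))
  have hc := hrel _ (Or.inr (Or.inr (Or.inl rfl)))
  have hab := hrel _ (Or.inr (Or.inr (Or.inr (Or.inl rfl))))
  have hbc := hrel _ (Or.inr (Or.inr (Or.inr (Or.inr (Or.inl rfl)))))
  have habc := hrel _ (Or.inr (Or.inr (Or.inr (Or.inr (Or.inr rfl)))))
  simp only [map_pow, map_mul] at ha hb hc hab hbc habc
  obtain ⟨A, hA, hA3⟩ := exists_lift_pow_eq_one (by decide) ha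
  obtain ⟨B, hB, hB5⟩ := exists_lift_pow_eq_one (by decide) hb
  obtain ⟨C, hC, hC3⟩ := exists_lift_pow_eq_one (by decide) hc
  have hind : Induces A B C f := induces_of_generators fun i => by
    fin_cases i
    exacts [hA.symm, hB.symm, hC.symm]
  have hne : ¬ ((A : PSL(2, F)) = 1 ∧
      (B : PSL(2, F)) = 1 ∧
      (C : PSL(2, F)) = 1) := by
    rintro ⟨h1, h2, h3⟩
    have hone : f = 1 := PresentedGroup.ext fun i => by
      fin_cases i
      exacts [hA.symm.trans h1, hB.symm.trans h2, hC.symm.trans h3]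
    obtain ⟨y, hy⟩ := hf ((up 1 : SL(2, F)) : PSL(2, F))
    rw [hone, MonoidHom.one_apply, eq_comm, coe_eq_one_iff, isPM_up] at hy
    exact one_ne_zero hy
  rw [← hA, ← hB] at hab
  rw [← hB, ← hC] at hbc
  rw [← hA, ← hB, ← hC] at habc
  rw [← hA] at ha
  rw [← hB] at hb
  rw [← hC] at hc
  have hnot := mt (eq_one_of_relations ha hb hc hab hbc habc) hne
  simp only [← QuotientGroup.mk_mul, ← QuotientGroup.mk_pow, coe_eq_one_iff, not_or]
    at hnot hab hbc habc
  obtain ⟨n1, n2, n3, n4, n5, n6⟩ := hnot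
  refine ⟨tr B, tr (A * C), A, B, C, ⟨⟨?_, tr_of_cube_eq_one hA3 n1, rfl, ?_⟩, ?_, ?_, ?_, rfl⟩,
    hind⟩
  · linear_combination tr_of_pow_five_eq_one hB5 n2
  · exact tr_eq_zero_of_sq hab n4
  · exact tr_of_cube_eq_one hC3 n3
  · exact tr_eq_zero_of_sq hbc n5
  · exact tr_eq_zero_of_sq habc n6

end Homs

section Automorphisms

variable {F : Type*} [Field F]

lemma coe_eq_coe {g h : SL(2, F)} : (g : PSL(2, F)) = h ↔ g = h ∨ g = -h := by
  rw [QuotientGroup.eq, mem_center, IsPM, inv_mul_eq_one, inv_mul_eq_iff_eq_mul, mul_neg, mul_one]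
  exact or_congr Iff.rfl ⟨fun e => by rw [e, neg_neg], fun e => by rw [e, neg_neg]⟩

lemma tr_eq_two_of_pow {p : ℕ} [Fact p.Prime] [CharP F p] {g : SL(2, F)} (hg : g ^ p = 1) :
    tr g = 2 := by
  have h1 : (g.1 - 1) ^ p = 0 := by
    have h2 : g.1 ^ p = 1 := congrArg Subtype.val hg
    rw [sub_pow_char_of_commute, h2, one_pow, sub_self]
    exact Commute.one_right _
  have h2 := (Matrix.isNilpotent_trace_of_isNilpotent ⟨p, h1⟩).eq_zero
  rw [trace_sub, trace_one, trace_fin_two, sub_eq_zero] at h2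
  simpa [tr] using h2

lemma up_pow_char {p : ℕ} [CharP F p] (t : F) : up t ^ p = 1 := by
  have : ∀ n : ℕ, up t ^ n = up (n * t) := by
    intro n
    induction n with
    | zero => simp [up_zero]
    | succ n ih => rw [pow_succ, ih, ← up_add]; congr 1; push_cast; ring
  rw [this, CharP.cast_eq_zero, zero_mul, up_zero]

lemma lo_pow_char {p : ℕ} [CharP F p] (t : F) : lo t ^ p = 1 := by
  have : ∀ n : ℕ, lo t ^ n = lo (n * t) := by
    intro n
    induction n with
    | zero => apply sl_ext <;> simp
    | succ n ih => rw [pow_succ, ih, ← lo_add]; congr 1; push_cast; ring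
  rw [this, CharP.cast_eq_zero, zero_mul]
  apply sl_ext <;> simp

lemma eq_up_of_commute (h2 : (2 : F) ≠ 0) {g : SL(2, F)} (hg : tr g = 2) {b : F} (hb : b ≠ 0)
    (hc : Commute (g : PSL(2, F)) (up b : SL(2, F))) : ∃ s, g = up s := by
  have hd := det_eq g
  simp only [tr] at hg
  have hc := coe_eq_coe.1 hc.eq
  simp [sl_ext_iff] at hc
  refine ⟨g.1 0 1, sl_ext ?_ ?_ ?_ ?_⟩ <;> simp <;> grind

lemma eq_lo_of_commute (h2 : (2 : F) ≠ 0) {g : SL(2, F)} (hg : tr g = 2) {b : F} (hb : b ≠ 0)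
    (hc : Commute (g : PSL(2, F)) (lo b : SL(2, F))) : ∃ s, g = lo s := by
  have hd := det_eq g
  simp only [tr] at hg
  have hc := coe_eq_coe.1 hc.eq
  simp [sl_ext_iff] at hc
  refine ⟨g.1 1 0, sl_ext ?_ ?_ ?_ ?_⟩ <;> simp <;> grind

lemma coe_up_injective {a b : F}
    (h : ((up a : SL(2, F)) : PSL(2, F)) = (up b : SL(2, F))) : a = b := by
  have := coe_eq_coe.1 h
  simp [sl_ext_iff] at this
  grind

lemma coe_lo_injective {a b : F}
    (h : ((lo a : SL(2, F)) : PSL(2, F)) = (lo b : SL(2, F))) : a = b := by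
  have := coe_eq_coe.1 h
  simp [sl_ext_iff] at this
  grind

/-- A lift to `SL(2, F)` of the image of an element of order `p`. -/
lemma exists_lift_tr_eq_two {p : ℕ} [Fact p.Prime] [CharP F p] (hp2 : p ≠ 2)
    (θ : PSL(2, F) →* PSL(2, F)) {g : SL(2, F)} (hg : g ^ p = 1) :
    ∃ h : SL(2, F), (h : PSL(2, F)) = θ g ∧ tr h = 2 := by
  have hp : p.Prime := Fact.out
  obtain ⟨h, h1, h3⟩ := exists_lift_pow_eq_one (g := θ g) (hp.odd_of_ne_two hp2) (by
    rw [← map_pow, ← QuotientGroup.mk_pow, hg, QuotientGroup.mk_one, map_one])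
  exact ⟨h, h1, tr_eq_two_of_pow h3⟩

/-- An injective endomorphism of `PSL(2, F)` is conjugate to one preserving the two standard
unipotent subgroups. -/
lemma exists_conj_unipotent {p : ℕ} [Fact p.Prime] [CharP F p] (hp2 : p ≠ 2)
    {θ : PSL(2, F) →* PSL(2, F)} (hθ : Function.Injective θ) :
    ∃ (Q : SL(2, F)) (b c : F), b ≠ 0 ∧ c ≠ 0 ∧
      MulAut.conj (Q : PSL(2, F)) (θ (up 1 : SL(2, F))) = (up b : SL(2, F)) ∧
      MulAut.conj (Q : PSL(2, F)) (θ (lo 1 : SL(2, F))) = (lo c : SL(2, F)) := by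
  have h2 : (2 : F) ≠ 0 := Ring.two_ne_zero (by rw [ringChar.eq F p]; exact hp2)
  obtain ⟨g, hg, tg⟩ := exists_lift_tr_eq_two hp2 θ (up_pow_char (p := p) (1 : F))
  obtain ⟨h, hh, th⟩ := exists_lift_tr_eq_two hp2 θ (lo_pow_char (p := p) (1 : F))
  obtain ⟨P, b, hP⟩ := exists_conj_up tg
  have hcomm : ¬ Commute g h := by
    intro hc
    have h3 := congrArg (QuotientGroup.mk (s := Subgroup.center SL(2, F))) hc.eq
    rw [QuotientGroup.mk_mul, QuotientGroup.mk_mul, hg, hh, ← map_mul, ← map_mul] at h3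
    have h4 := coe_eq_coe.1 (hθ h3)
    simp [sl_ext_iff] at h4
    grind
  obtain ⟨k, hk⟩ : ∃ k, k = P⁻¹ * h * P := ⟨_, rfl⟩
  have tk : tr k = 2 := by rw [hk, tr_conj', th]
  have hd := det_eq k
  have hcomm' : ¬ Commute (up b) k := by
    rw [← hP, hk]
    intro hc
    apply hcomm
    have := hc.eq
    simp only [mul_assoc, mul_inv_cancel_left, mul_right_inj] at this
    rwa [← mul_assoc, ← mul_assoc, mul_left_inj] at this
  have hb : b ≠ 0 := by
    rintro rfl
    rw [up_zero] at hcomm'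
    exact hcomm' (Commute.one_left _)
  have hc : k.1 1 0 ≠ 0 := by
    intro h0
    apply hcomm'
    simp only [tr] at tk
    have : k.1 0 0 = 1 := by
      have : (k.1 0 0 - 1) ^ 2 = 0 := by grind
      grind
    apply sl_ext <;> simp <;> grind
  simp only [tr] at tk
  have e1 : up ((1 - k.1 0 0) / k.1 1 0) * P⁻¹ * g * (up ((1 - k.1 0 0) / k.1 1 0) * P⁻¹)⁻¹ =
      up b := by
    rw [_root_.mul_inv_rev, inv_inv, ← up_neg]
    rw [show ∀ x y : SL(2, F), x * P⁻¹ * g * (P * y) = x * (P⁻¹ * g * P) * y by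
      intros; simp only [mul_assoc], hP, ← up_add, ← up_add]
    congr 1; ring
  have e2 : up ((1 - k.1 0 0) / k.1 1 0) * P⁻¹ * h * (up ((1 - k.1 0 0) / k.1 1 0) * P⁻¹)⁻¹ =
      lo (k.1 1 0) := by
    rw [_root_.mul_inv_rev, inv_inv, ← up_neg]
    rw [show ∀ x y : SL(2, F), x * P⁻¹ * h * (P * y) = x * (P⁻¹ * h * P) * y by
      intros; simp only [mul_assoc], ← hk]
    apply sl_ext <;> simp <;> grind
  refine ⟨up ((1 - k.1 0 0) / k.1 1 0) * P⁻¹, b, k.1 1 0, hb, hc, ?_, ?_⟩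
  · rw [← hg, ← e1]; rfl
  · rw [← hh, ← e2]; rfl

/-- An injective endomorphism of `PSL(2, F)` preserving the two standard unipotent subgroups is
given by a field homomorphism. -/
lemma exists_ringHom_of_unipotent {p : ℕ} [Fact p.Prime] [CharP F p] (hp2 : p ≠ 2)
    {θ : PSL(2, F) →* PSL(2, F)} {b c : F} (hb : b ≠ 0) (hc : c ≠ 0)
    (hup : θ (up 1 : SL(2, F)) = (up b : SL(2, F)))
    (hlo : θ (lo 1 : SL(2, F)) = (lo c : SL(2, F))) :
    ∃ σ : F →+* F, ∀ g h : SL(2, F), θ g = h → tr h ^ 2 = σ (tr g) ^ 2 := by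
  have h2 : (2 : F) ≠ 0 := Ring.two_ne_zero (by rw [ringChar.eq F p]; exact hp2)
  have hU : ∀ t : F, ∃ u, θ (up t : SL(2, F)) = (up u : SL(2, F)) := by
    intro t
    obtain ⟨h, hh, th⟩ := exists_lift_tr_eq_two hp2 θ (up_pow_char (p := p) t)
    have hcomm : Commute (h : PSL(2, F)) (up b : SL(2, F)) := by
      rw [hh, ← hup]
      refine Commute.map ?_ θ
      rw [Commute, SemiconjBy, ← QuotientGroup.mk_mul, ← QuotientGroup.mk_mul, ← up_add, ← up_add,
        add_comm]
    obtain ⟨u, rfl⟩ := eq_up_of_commute h2 th hb hcomm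
    exact ⟨u, hh.symm⟩
  have hL : ∀ t : F, ∃ u, θ (lo t : SL(2, F)) = (lo u : SL(2, F)) := by
    intro t
    obtain ⟨h, hh, th⟩ := exists_lift_tr_eq_two hp2 θ (lo_pow_char (p := p) t)
    have hcomm : Commute (h : PSL(2, F)) (lo c : SL(2, F)) := by
      rw [hh, ← hlo]
      refine Commute.map ?_ θ
      rw [Commute, SemiconjBy, ← QuotientGroup.mk_mul, ← QuotientGroup.mk_mul, ← lo_add, ← lo_add,
        add_comm]
    obtain ⟨u, rfl⟩ := eq_lo_of_commute h2 th hc hcomm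
    exact ⟨u, hh.symm⟩
  choose u hu using hU
  choose l hl using hL
  have u_one : u 1 = b := coe_up_injective ((hu 1).symm.trans hup)
  have l_one : l 1 = c := coe_lo_injective ((hl 1).symm.trans hlo)
  have u_add : ∀ s t, u (s + t) = u s + u t := fun s t => coe_up_injective (by
    rw [← hu, up_add, up_add, QuotientGroup.mk_mul, QuotientGroup.mk_mul, map_mul, hu, hu])
  have l_add : ∀ s t, l (s + t) = l s + l t := fun s t => coe_lo_injective (by
    rw [← hl, lo_add, lo_add, QuotientGroup.mk_mul, QuotientGroup.mk_mul, map_mul, hl, hl])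
  have l_neg : ∀ t, l (-t) = -l t := fun t => map_neg (AddMonoidHom.mk' l l_add) t
  have hw : ∀ t, t ≠ 0 → (u t * l t⁻¹ = 1 ∧ b = l (t⁻¹ ^ 2) * u t ^ 2) := by
    intro t ht
    have e1 : up t * lo (-t⁻¹) * up t * up 1 = lo (-t⁻¹ ^ 2) * (up t * lo (-t⁻¹) * up t) := by
      apply sl_ext <;> simp <;> grind
    have e2 := congrArg (fun g : SL(2, F) => θ g) e1
    simp only [QuotientGroup.mk_mul, map_mul, hu, hl, u_one, l_neg] at e2
    simp only [← QuotientGroup.mk_mul] at e2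
    have e3 := coe_eq_coe.1 e2
    simp [sl_ext_iff] at e3
    constructor <;> grind
  have hbc : b * c = 1 := by
    have := (hw 1 one_ne_zero).1
    rwa [u_one, inv_one, l_one] at this
  have u_sq : ∀ t, u (t ^ 2) * b = u t ^ 2 := by
    intro t
    rcases eq_or_ne t 0 with rfl | ht
    · have : u 0 = 0 := map_zero (AddMonoidHom.mk' u u_add)
      simp [this]
    · have h3 := (hw (t ^ 2) (pow_ne_zero 2 ht)).1
      have h4 := (hw t ht).2
      rw [← inv_pow] at h3
      linear_combination u (t ^ 2) * h4 + u t ^ 2 * h3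
  have u_mul : ∀ s t, u (s * t) * b = u s * u t := by
    intro s t
    have h3 := u_sq (s + t)
    rw [show (s + t) ^ 2 = s ^ 2 + (s * t + s * t) + t ^ 2 by ring, u_add, u_add, u_add,
      u_add] at h3
    refine mul_left_cancel₀ h2 ?_
    linear_combination h3 - u_sq s - u_sq t
  let σ : F →+* F := RingHom.mk' ⟨⟨fun t => c * u t, by rw [u_one, mul_comm, hbc]⟩, fun s t => by
    linear_combination c ^ 2 * u_mul s t - c * u (s * t) * hbc⟩ fun s t => by
      simp [u_add, mul_add]
  have hσ : ∀ t, u t = b * σ t := fun t => by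
    change u t = b * (c * u t)
    linear_combination -u t * hbc
  have hσ' : ∀ t, l t = c * σ t := fun t => by
    rcases eq_or_ne t 0 with rfl | ht
    · rw [map_zero, mul_zero]
      exact map_zero (AddMonoidHom.mk' l l_add)
    · have h3 := (hw t⁻¹ (inv_ne_zero ht)).1
      rw [inv_inv, hσ, map_inv₀] at h3
      have : σ t ≠ 0 := by simpa
      field_simp at h3
      linear_combination c * h3 - l t * hbc
  let Ψ : SL(2, F) →* SL(2, F) :=
    { toFun := fun g => mat (σ (g.1 0 0)) (b * σ (g.1 0 1)) (c * σ (g.1 1 0)) (σ (g.1 1 1)) (by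
        have := congrArg σ (det_eq g)
        simp only [map_sub, map_mul, map_one] at this
        linear_combination this - σ (g.1 0 1) * σ (g.1 1 0) * hbc)
      map_one' := by apply sl_ext <;> simp
      map_mul' := fun g h => by apply sl_ext <;> simp <;> grind }
  have htop : (θ.comp (QuotientGroup.mk' _)).eqLocus ((QuotientGroup.mk' _).comp Ψ) = ⊤ := by
    refine eq_top_of_up_lo (fun t => (hu t).trans ?_) (fun t => (hl t).trans ?_)
    · refine congrArg _ (sl_ext ?_ ?_ ?_ ?_) <;> simp [Ψ, hσ]
    · refine congrArg _ (sl_ext ?_ ?_ ?_ ?_) <;> simp [Ψ, hσ']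
  refine ⟨σ, fun g h hgh => ?_⟩
  have hg : g ∈ (θ.comp (QuotientGroup.mk' _)).eqLocus ((QuotientGroup.mk' _).comp Ψ) :=
    htop ▸ Subgroup.mem_top g
  have hg' : tr (Ψ g) = σ (tr g) := by simp [Ψ, tr]
  rcases coe_eq_coe.1 (hgh.symm.trans hg) with rfl | rfl
  · rw [hg']
  · rw [tr_neg, hg', neg_sq]

/-- Traces transform under an injective endomorphism of `PSL(2, F)` by a field homomorphism. -/
lemma exists_ringHom_of_injective {p : ℕ} [Fact p.Prime] [CharP F p] (hp2 : p ≠ 2)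
    {θ : PSL(2, F) →* PSL(2, F)} (hθ : Function.Injective θ) :
    ∃ σ : F →+* F, ∀ g h : SL(2, F), θ g = h → tr h ^ 2 = σ (tr g) ^ 2 := by
  obtain ⟨Q, b, c, hb, hc, h1, h2⟩ := exists_conj_unipotent hp2 hθ
  obtain ⟨σ, hσ⟩ := exists_ringHom_of_unipotent hp2
    (θ := (MulAut.conj (Q : PSL(2, F))).toMonoidHom.comp θ) hb hc h1 h2
  refine ⟨σ, fun g h hgh => ?_⟩
  rw [← hσ g (Q * h * Q⁻¹) (by
    rw [QuotientGroup.mk_mul, QuotientGroup.mk_mul, ← hgh]; rfl), tr_conj]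

end Automorphisms

section Kernels

variable {F : Type*} [Field F]

/-- Triples inducing homomorphisms with the same kernel are related by a field homomorphism. -/
lemma exists_ringHom_of_ker_eq {p : ℕ} [Fact p.Prime] [CharP F p] (hp2 : p ≠ 2) {τ x x' : F}
    {A B C A' B' C' : SL(2, F)} (h : IsTriple τ x A B C) (h' : IsTriple τ x' A' B' C')
    {f f' : Tet →* PSL(2, F)} (hf : Induces A B C f) (hf' : Induces A' B' C' f')
    (hs : Function.Surjective f) (hker : f.ker = f'.ker) :
    ∃ σ : F →+* F, σ τ = τ ∧ σ x = x' := by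
  have hθ : ∃ θ : PSL(2, F) →* PSL(2, F), Function.Injective θ ∧ ∀ g, θ (f g) = f' g := by
    refine ⟨(QuotientGroup.kerLift f').comp
      ((QuotientGroup.quotientMulEquivOfEq hker).toMonoidHom.comp
      (QuotientGroup.quotientKerEquivOfSurjective f hs).symm.toMonoidHom), ?_, fun g => ?_⟩
    · exact (QuotientGroup.kerLift_injective f').comp
        ((QuotientGroup.quotientMulEquivOfEq hker).injective.comp
          (QuotientGroup.quotientKerEquivOfSurjective f hs).symm.injective)
    · have : (QuotientGroup.quotientKerEquivOfSurjective f hs).symm (f g) = (g : Tet ⧸ f.ker) := by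
        rw [MulEquiv.symm_apply_eq]; rfl
      simp only [MonoidHom.comp_apply, MulEquiv.coe_toMonoidHom]
      rw [this]
      rfl
  obtain ⟨θ, hinj, hθ⟩ := hθ
  obtain ⟨σ, hσ⟩ := exists_ringHom_of_injective hp2 hinj
  have key : ∀ w, tr (wordMap A' B' C' w) ^ 2 = σ (tr (wordMap A B C w)) ^ 2 := fun w =>
    hσ _ _ (by rw [← hf w, hθ, hf' w])
  have k1 := key (FreeGroup.of 1)
  have k2 := key (FreeGroup.of 0 * FreeGroup.of 2)
  simp only [wordMap, map_mul, FreeGroup.lift_apply_of] at k1 k2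
  change tr B' ^ 2 = σ (tr B) ^ 2 at k1
  change tr (A' * C') ^ 2 = σ (tr (A * C)) ^ 2 at k2
  rw [h.trB, h'.trB] at k1
  rw [h.trAC, h'.trAC] at k2
  have r1 := congrArg σ h.rel
  have r2 := congrArg σ h.param_rel
  simp only [map_add, map_sub, map_pow, map_one] at r1 r2
  have r3 : σ τ = τ := by linear_combination r1 - h.rel + k1
  exact ⟨σ, r3, by linear_combination h'.param_rel - k2 - r2 - r3⟩

end Kernels

section Field

variable {p : ℕ} [Fact p.Prime]

lemma not_isSquare_five (hp2 : p ≠ 2) (h5 : p % 5 = 2 ∨ p % 5 = 3) :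
    ¬ IsSquare (5 : ZMod p) := by
  have e2 : ∀ r : ZMod 5, (2 : ℕ) ≠ r * r := by decide
  have e3 : ∀ r : ZMod 5, (3 : ℕ) ≠ r * r := by decide
  have : Fact (Nat.Prime 5) := ⟨by norm_num⟩
  have h := ZMod.exists_sq_eq_prime_iff_of_mod_four_eq_one (p := 5) (q := p) (by norm_num) hp2
  rw [show ((5 : ℕ) : ZMod p) = 5 by norm_cast] at h
  rw [← h, ← ZMod.natCast_mod]
  rcases h5 with h | h <;> rw [h]
  · exact fun ⟨r, hr⟩ => e2 r hr
  · exact fun ⟨r, hr⟩ => e3 r hr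

lemma not_mem_bot {F : Type*} [Field F] [Algebra (ZMod p) F] (hp2 : p ≠ 2)
    (h5 : p % 5 = 2 ∨ p % 5 = 3) {s : F} (hs : s ^ 2 = 5) : s ∉ (algebraMap (ZMod p) F).range := by
  rintro ⟨r, rfl⟩
  refine not_isSquare_five hp2 h5 ⟨r, (algebraMap (ZMod p) F).injective ?_⟩
  rw [← pow_two, map_pow, hs, map_ofNat]

lemma frobenius_sqrt_five (hp2 : p ≠ 2) (h5 : p % 5 = 2 ∨ p % 5 = 3) {s : GaloisField p 2}
    (hs : s ^ 2 = 5) : frobenius (GaloisField p 2) p s = -s := by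
  have h1 : frobenius (GaloisField p 2) p s ^ 2 = s ^ 2 := by rw [← map_pow, hs, map_ofNat]
  rcases sq_eq_sq_iff_eq_or_eq_neg.1 h1 with h | h
  · have h2 := (Subfield.mem_bot_iff_pow_eq_self (GaloisField p 2) p).2 h
    rw [Subfield.bot_eq_of_zMod_algebra p] at h2
    exact absurd h2 (not_mem_bot hp2 h5 hs)
  · exact h

/-- An endomorphism of the field with `p ^ 2` elements fixing a square root of `5` is trivial. -/
lemma ringHom_eq_id (hp2 : p ≠ 2) (h5 : p % 5 = 2 ∨ p % 5 = 3)
    {s : GaloisField p 2} (hs : s ^ 2 = 5) (σ : GaloisField p 2 →+* GaloisField p 2)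
    (hσ : σ s = s) (x : GaloisField p 2) : σ x = x := by
  let K : IntermediateField (ZMod p) (GaloisField p 2) :=
    (σ.eqLocusField (RingHom.id _)).toIntermediateField
      (DFunLike.congr_fun
        (RingHom.ext_zmod (σ.comp (algebraMap (ZMod p) _)) (algebraMap (ZMod p) _)))
  have hsimple : IsSimpleOrder (IntermediateField (ZMod p) (GaloisField p 2)) :=
    IntermediateField.isSimpleOrder_of_finrank_prime _ _ (by
      rw [GaloisField.finrank p two_ne_zero]; exact Nat.prime_two)
  have hs' : s ∈ K := hσ
  rcases hsimple.eq_bot_or_eq_top K with h | h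
  · rw [h, IntermediateField.mem_bot] at hs'
    exact absurd hs' (not_mem_bot hp2 h5 hs)
  · exact (h ▸ IntermediateField.mem_top : x ∈ K)

end Field

end TetPSL

open TetPSL

theorem stmt_5 (p : ℕ) [Fact p.Prime] (hp : p ≠ 2)
    (h5 : p % 5 = 2 ∨ p % 5 = 3)
    (s : GaloisField p 2) (hs : s ^ 2 = 5)
    (hsq : IsSquare (3 + 2 * s) ∧ IsSquare (3 - 2 * s)) :
    {K : Subgroup Tet | IsPSLQuotient (GaloisField p 2) K}.ncard = 2 := by
  have hchar : ringChar (GaloisField p 2) ≠ 2 := by rwa [ringChar.eq (GaloisField p 2) p]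
  have h2 : (2 : GaloisField p 2) ≠ 0 := Ring.two_ne_zero hchar
  have hF : Nat.card (GaloisField p 2) = p ^ 2 := GaloisField.card p 2 two_ne_zero
  obtain ⟨d, hd⟩ := hsq.1
  obtain ⟨τ, hτs⟩ : ∃ τ, s = 2 * τ + 1 := ⟨(s - 1) / 2, by field_simp; ring⟩
  obtain ⟨x, hxd⟩ : ∃ x, d = 2 * x - 1 := ⟨(d + 1) / 2, by field_simp; ring⟩
  have h4 : (2 : GaloisField p 2) * 2 ≠ 0 := mul_ne_zero h2 h2
  have hτ : τ ^ 2 + τ = 1 := mul_left_cancel₀ h4 (by rw [hτs] at hs; linear_combination hs)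
  have hx : x ^ 2 - x = 1 + τ :=
    mul_left_cancel₀ h4 (by rw [hxd, hτs] at hd; linear_combination -hd)
  have hd0 : d ≠ 0 := by
    rintro rfl
    have h11 : ((11 : ℕ) : GaloisField p 2) = 0 := by
      push_cast
      linear_combination (2 * s - 3) * hd - 4 * hs
    rw [CharP.cast_eq_zero_iff _ p, Nat.prime_dvd_prime_iff_eq Fact.out (by norm_num)] at h11
    omega
  obtain ⟨A, B, hAB⟩ := exists_isPair h2 hτ
  obtain ⟨C, hC⟩ := hAB.exists_triple hx
  obtain ⟨C', hC'⟩ := hAB.exists_triple (x := 1 - x) (by linear_combination hx)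
  obtain ⟨f, hf⟩ := hC.exists_induces
  obtain ⟨f', hf'⟩ := hC'.exists_induces
  have hfs := hC.surjective hp h5 hF hf
  have hfs' := hC'.surjective hp h5 hF hf'
  have hne : f.ker ≠ f'.ker := by
    intro hker
    obtain ⟨σ, h1, h3⟩ := exists_ringHom_of_ker_eq hp hC hC' hf hf' hfs hker
    rw [ringHom_eq_id hp h5 hs σ (by rw [hτs, map_add, map_mul, map_ofNat, map_one, h1])] at h3
    exact hd0 (by linear_combination hxd + h3)
  have hset : {K : Subgroup Tet | IsPSLQuotient (GaloisField p 2) K} = {f.ker, f'.ker} := by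
    ext K
    rw [Set.mem_ofPred_eq, Set.mem_insert_iff, Set.mem_singleton_iff]
    constructor
    · rintro ⟨g, hg, rfl⟩
      obtain ⟨τ', y, A', B', D, hD, hgi⟩ := exists_triple_of_surjective hg
      obtain ⟨σ, hσ⟩ : ∃ σ : GaloisField p 2 →+* GaloisField p 2, τ' = σ τ := by
        have : (τ' - τ) * (τ' - (-1 - τ)) = 0 := by linear_combination hD.rel - hτ
        rcases mul_eq_zero.1 this with h | h
        · exact ⟨RingHom.id _, sub_eq_zero.1 h⟩
        · refine ⟨frobenius _ p, ?_⟩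
          have h6 := frobenius_sqrt_five hp h5 hs
          rw [hτs, map_add, map_mul, map_ofNat, map_one] at h6
          exact mul_left_cancel₀ h2 (by linear_combination 2 * h - h6)
      subst hσ
      have hσx := congrArg σ hx
      simp only [map_add, map_sub, map_pow, map_one] at hσx
      have : (y - σ x) * (y - σ (1 - x)) = 0 := by
        rw [map_sub, map_one]
        linear_combination hD.param_rel - hσx
      rcases mul_eq_zero.1 this with h | h
      · left
        obtain rfl := sub_eq_zero.1 h
        exact (hf.ker_eq hgi σ hC hD).symm
      · right
        obtain rfl := sub_eq_zero.1 h
        exact (hf'.ker_eq hgi σ hC' hD).symm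
    · rintro (rfl | rfl)
      exacts [⟨f, hfs, rfl⟩, ⟨f', hfs', rfl⟩]
  rw [hset, Set.ncard_pair hne]
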